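/- arXiv:1705.03117 — 3 statements merged into one kernel-verified Lean document; each statement's English description precedes it below -/
import Mathlib

section
/- Let n ≥ 0 and let V be a finite-dimensional real vector space with a nondegenerate bilinear form Q that is symmetric if n is even and alternating if n is odd. Two ℝ-split polarized mixed Hodge structures (I₁,N₁) and (I₂,N₂) of weight n on (V,Q) have equal Hodge diamonds (dim_ℂ I₁^{p,q} = dim_ℂ I₂^{p,q} for all p,q) if and only if they are conjugate under Aut(V,Q), i.e. there exists a real linear automorphism g of V preserving Q with g(I₁^{p,q}) = I₂^{p,q} for all p,q and g N₁ g^{−1} = N₂. -/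
/-- `(I, N)` is an ℝ-split polarized mixed Hodge structure of weight `n` on the
subspace `S` of the "complexified" space `W`, relative to the real structure
(conjugation) `σ` and the bilinear form `Q`. -/
def IsRSplitPMHSOn {W : Type*} [AddCommGroup W] [Module ℂ W]
    (n : ℤ) (S : Submodule ℂ W)
    (σ : W →ₛₗ[starRingEnd ℂ] W)
    (Q : W →ₗ[ℂ] W →ₗ[ℂ] ℂ)
    (I : ℤ → ℤ → Submodule ℂ W) (N : W →ₗ[ℂ] W) : Prop :=
  (∃ m : ℕ, ∀ v ∈ S, (N ^ m) v = 0) ∧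
  (∀ u ∈ S, ∀ v ∈ S, Q (N u) v + Q u (N v) = 0) ∧
  (∀ v ∈ S, N v ∈ S) ∧
  (∀ v ∈ S, σ v ∈ S) ∧
  (∀ v ∈ S, N (σ v) = σ (N v)) ∧
  (∀ p q : ℤ, I p q ≤ S) ∧
  iSupIndep (fun pq : ℤ × ℤ => I pq.1 pq.2) ∧
  (⨆ pq : ℤ × ℤ, I pq.1 pq.2) = S ∧
  (∀ p q : ℤ, ∀ u ∈ I p q, σ u ∈ I q p) ∧
  (∀ p q : ℤ, ∀ u ∈ I p q, N u ∈ I (p - 1) (q - 1)) ∧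
  (∀ p q r s : ℤ, p + r ≠ n ∨ q + s ≠ n →
      ∀ u ∈ I p q, ∀ v ∈ I r s, Q u v = 0) ∧
  (∀ k : ℕ, ∀ p q : ℤ, p + q = n + k →
      (∀ u ∈ I p q, (N ^ k) u = 0 → u = 0) ∧
      (∀ v ∈ I (p - k) (q - k), ∃ u ∈ I p q, (N ^ k) u = v)) ∧
  (∀ k : ℕ, ∀ p q : ℤ, p + q = n + k → ∀ u ∈ I p q, (N ^ (k + 1)) u = 0 → u ≠ 0 →
      ∃ r : ℝ, 0 < r ∧ Complex.I ^ (p - q) * Q u ((N ^ k) (σ u)) = (r : ℂ))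

/-- `(I, N)` is an ℝ-split polarized mixed Hodge structure of weight `n` on all of `W`. -/
def IsRSplitPMHS {W : Type*} [AddCommGroup W] [Module ℂ W]
    (n : ℤ) (σ : W →ₛₗ[starRingEnd ℂ] W)
    (Q : W →ₗ[ℂ] W →ₗ[ℂ] ℂ)
    (I : ℤ → ℤ → Submodule ℂ W) (N : W →ₗ[ℂ] W) : Prop :=
  IsRSplitPMHSOn n ⊤ σ Q I N

/-- Two spanning families with the same Gram matrix for a nondegenerate form differ by an
isometry. -/
theorem exists_isometry_of_gram_eq {W ι : Type*} [AddCommGroup W] [Module ℂ W]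
    (Q : W →ₗ[ℂ] W →ₗ[ℂ] ℂ) (hQ : ∀ u, (∀ v, Q u v = 0) → u = 0) (b c : ι → W)
    (hb : Submodule.span ℂ (Set.range b) = ⊤) (hc : Submodule.span ℂ (Set.range c) = ⊤)
    (h : ∀ i j, Q (b i) (b j) = Q (c i) (c j)) :
    ∃ g : W ≃ₗ[ℂ] W, (∀ i, g (b i) = c i) ∧ ∀ u v, Q (g u) (g v) = Q u v := by
  set B := Finsupp.linearCombination ℂ b with hB
  set C := Finsupp.linearCombination ℂ c with hC
  have hBs : Function.Surjective B := by
    rw [← LinearMap.range_eq_top, hB, Finsupp.range_linearCombination, hb]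
  have hCs : Function.Surjective C := by
    rw [← LinearMap.range_eq_top, hC, Finsupp.range_linearCombination, hc]
  have hBC : ∀ x y, Q (B x) (B y) = Q (C x) (C y) := by
    intro x y
    have : (Q.compl₁₂ B B) = (Q.compl₁₂ C C) := by
      ext i j
      simp [hB, hC, h]
    exact congrArg (fun f => f x y) this
  have hker : LinearMap.ker B = LinearMap.ker C := by
    ext x
    simp only [LinearMap.mem_ker]
    constructor
    · intro hx
      apply hQ
      intro v
      obtain ⟨y, rfl⟩ := hCs v
      rw [← hBC, hx]; simp
    · intro hx
      apply hQ
      intro v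
      obtain ⟨y, rfl⟩ := hBs v
      rw [hBC, hx]; simp
  let g := (B.quotKerEquivOfSurjective hBs).symm ≪≫ₗ
    Submodule.quotEquivOfEq _ _ hker ≪≫ₗ C.quotKerEquivOfSurjective hCs
  have hg : ∀ x, g (B x) = C x := by
    intro x
    have : (B.quotKerEquivOfSurjective hBs).symm (B x) = Submodule.Quotient.mk x := by
      rw [LinearEquiv.symm_apply_eq]; rfl
    simp only [g, LinearEquiv.trans_apply, this]
    rfl
  refine ⟨g, fun i => ?_, fun u v => ?_⟩
  · simpa [hB, hC] using hg (Finsupp.single i 1)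
  · obtain ⟨x, rfl⟩ := hBs u
    obtain ⟨y, rfl⟩ := hBs v
    rw [hg, hg, hBC]

/-- A finite-dimensional inner product space has an orthonormal spanning family. -/
theorem InnerProductSpace.Core.exists_orthonormal {𝕜 V : Type*} [RCLike 𝕜] [AddCommGroup V]
    [Module 𝕜 V] [FiniteDimensional 𝕜 V] (c : InnerProductSpace.Core 𝕜 V) :
    ∃ e : Fin (Module.finrank 𝕜 V) → V, Submodule.span 𝕜 (Set.range e) = ⊤ ∧
      ∀ a b, c.inner (e a) (e b) = if a = b then 1 else 0 := by
  let _ : NormedAddCommGroup V := c.toNormedAddCommGroup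
  let _ : InnerProductSpace 𝕜 V := InnerProductSpace.ofCore c.toCore
  have e := stdOrthonormalBasis 𝕜 V
  refine ⟨e, ?_, ?_⟩
  · simpa using e.toBasis.span_eq
  · exact orthonormal_iff_ite.mp e.orthonormal

/-- The primitive subspace of `I p q`, where `p + q = n + k`. -/
def primitivePart {W : Type*} [AddCommGroup W] [Module ℂ W]
    (I : ℤ → ℤ → Submodule ℂ W) (N : W →ₗ[ℂ] W) (k : ℕ) (p q : ℤ) : Submodule ℂ W :=
  I p q ⊓ LinearMap.ker (N ^ (k + 1))

namespace IsRSplitPMHS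

section

variable {W : Type*} [AddCommGroup W] [Module ℂ W]
  {n : ℤ} {σ : W →ₛₗ[starRingEnd ℂ] W} {Q : W →ₗ[ℂ] W →ₗ[ℂ] ℂ}
  {I : ℤ → ℤ → Submodule ℂ W} {N : W →ₗ[ℂ] W}

theorem exists_pow_eq_zero (h : IsRSplitPMHS n σ Q I N) : ∃ m : ℕ, ∀ v, (N ^ m) v = 0 := by
  obtain ⟨m, hm⟩ := h.1
  exact ⟨m, fun v => hm v trivial⟩

theorem form_map (h : IsRSplitPMHS n σ Q I N) (u v : W) : Q (N u) v = - Q u (N v) :=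
  eq_neg_of_add_eq_zero_left (h.2.1 u trivial v trivial)

theorem form_pow_map (h : IsRSplitPMHS n σ Q I N) (j : ℕ) (u v : W) :
    Q ((N ^ j) u) v = (-1) ^ j * Q u ((N ^ j) v) := by
  induction j generalizing v with
  | zero => simp
  | succ j ih =>
    rw [pow_succ', Module.End.mul_apply, h.form_map, ih, ← Module.End.mul_apply, ← pow_succ,
      ← pow_succ']
    ring

theorem map_conj (h : IsRSplitPMHS n σ Q I N) (v : W) : N (σ v) = σ (N v) :=
  h.2.2.2.2.1 v trivial

theorem pow_map_conj (h : IsRSplitPMHS n σ Q I N) (j : ℕ) (v : W) :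
    (N ^ j) (σ v) = σ ((N ^ j) v) := by
  induction j with
  | zero => simp
  | succ j ih => simp only [pow_succ', Module.End.mul_apply, ih, h.map_conj]

theorem iSup_eq_top (h : IsRSplitPMHS n σ Q I N) : (⨆ pq : ℤ × ℤ, I pq.1 pq.2) = ⊤ :=
  h.2.2.2.2.2.2.2.1

theorem conj_mem (h : IsRSplitPMHS n σ Q I N) {p q : ℤ} {u : W} (hu : u ∈ I p q) :
    σ u ∈ I q p :=
  h.2.2.2.2.2.2.2.2.1 p q u hu

theorem pow_map_mem (h : IsRSplitPMHS n σ Q I N) (j : ℕ) {p q : ℤ} {u : W} (hu : u ∈ I p q) :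
    (N ^ j) u ∈ I (p - j) (q - j) := by
  induction j with
  | zero => simpa using hu
  | succ j ih =>
    have := h.2.2.2.2.2.2.2.2.2.1 _ _ _ ih
    rw [pow_succ', Module.End.mul_apply]
    push_cast
    rwa [← sub_sub, ← sub_sub]

theorem form_eq_zero (h : IsRSplitPMHS n σ Q I N) {p q r s : ℤ} (hpq : p + r ≠ n ∨ q + s ≠ n)
    {u v : W} (hu : u ∈ I p q) (hv : v ∈ I r s) : Q u v = 0 :=
  h.2.2.2.2.2.2.2.2.2.2.1 p q r s hpq u hu v hv

theorem eq_zero_of_pow (h : IsRSplitPMHS n σ Q I N) {k : ℕ} {p q : ℤ} (hk : p + q = n + k)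
    {u : W} (hu : u ∈ I p q) (h0 : (N ^ k) u = 0) : u = 0 :=
  (h.2.2.2.2.2.2.2.2.2.2.2.1 k p q hk).1 u hu h0

theorem exists_pow_eq (h : IsRSplitPMHS n σ Q I N) {k : ℕ} {p q : ℤ} (hk : p + q = n + k)
    {v : W} (hv : v ∈ I (p - k) (q - k)) : ∃ u ∈ I p q, (N ^ k) u = v :=
  (h.2.2.2.2.2.2.2.2.2.2.2.1 k p q hk).2 v hv

theorem exists_form_pos (h : IsRSplitPMHS n σ Q I N) {k : ℕ} {p q : ℤ} (hk : p + q = n + k)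
    {u : W} (hu : u ∈ primitivePart I N k p q) (h0 : u ≠ 0) :
    ∃ r : ℝ, 0 < r ∧ Complex.I ^ (p - q) * Q u ((N ^ k) (σ u)) = (r : ℂ) :=
  h.2.2.2.2.2.2.2.2.2.2.2.2 k p q hk u hu.1 hu.2 h0

theorem conj_mem_primitivePart (h : IsRSplitPMHS n σ Q I N) {k : ℕ} {p q : ℤ} {u : W}
    (hu : u ∈ primitivePart I N k p q) : σ u ∈ primitivePart I N k q p := by
  refine ⟨h.conj_mem hu.1, ?_⟩
  have : (N ^ (k + 1)) u = 0 := hu.2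
  rw [SetLike.mem_coe, LinearMap.mem_ker, h.pow_map_conj, this, map_zero]

theorem exists_sub_mem_primitivePart (h : IsRSplitPMHS n σ Q I N) {k : ℕ} {p q : ℤ}
    (hk : p + q = n + k) {u : W} (hu : u ∈ I p q) :
    ∃ w ∈ I (p + 1) (q + 1), (N ^ (k + 2)) w = (N ^ (k + 1)) u ∧
      u - N w ∈ primitivePart I N k p q := by
  have h1 := h.pow_map_mem (k + 1) hu
  have h2 : (N ^ (k + 1)) u ∈ I (p + 1 - (k + 2 : ℕ)) (q + 1 - (k + 2 : ℕ)) := by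
    rwa [show p + 1 - ((k + 2 : ℕ) : ℤ) = p - (k + 1 : ℕ) by push_cast; ring,
      show q + 1 - ((k + 2 : ℕ) : ℤ) = q - (k + 1 : ℕ) by push_cast; ring]
  obtain ⟨w, hw, hwu⟩ := h.exists_pow_eq (p := p + 1) (q := q + 1) (k := k + 2)
    (by push_cast; linarith) h2
  refine ⟨w, hw, hwu, ?_, ?_⟩
  · have := h.pow_map_mem 1 hw
    simp only [pow_one, Nat.cast_one, add_sub_cancel_right] at this
    exact sub_mem hu this
  · rw [SetLike.mem_coe, LinearMap.mem_ker, map_sub, ← Module.End.mul_apply, ← pow_succ, hwu, sub_self]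

theorem finrank_primitivePart_add [FiniteDimensional ℂ W] (h : IsRSplitPMHS n σ Q I N)
    {k : ℕ} {p q : ℤ} (hk : p + q = n + k) :
    Module.finrank ℂ (primitivePart I N k p q) + Module.finrank ℂ (I (p + 1) (q + 1)) =
      Module.finrank ℂ (I p q) := by
  have h1 := ((N ^ (k + 1)).domRestrict (I p q)).finrank_range_add_finrank_ker
  have h2 := ((N ^ (k + 2)).domRestrict (I (p + 1) (q + 1))).finrank_range_add_finrank_ker
  have h3 : LinearMap.ker ((N ^ (k + 2)).domRestrict (I (p + 1) (q + 1))) = ⊥ := by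
    rw [LinearMap.ker_eq_bot']
    rintro ⟨w, hw⟩ h0
    exact Subtype.ext (h.eq_zero_of_pow (k := k + 2) (by push_cast; linarith) hw h0)
  have h4 : LinearMap.range ((N ^ (k + 1)).domRestrict (I p q)) =
      LinearMap.range ((N ^ (k + 2)).domRestrict (I (p + 1) (q + 1))) := by
    apply le_antisymm
    · rintro _ ⟨⟨u, hu⟩, rfl⟩
      obtain ⟨w, hw, hwu, -⟩ := h.exists_sub_mem_primitivePart hk hu
      exact ⟨⟨w, hw⟩, hwu⟩
    · rintro _ ⟨⟨w, hw⟩, rfl⟩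
      have := h.pow_map_mem 1 hw
      simp only [pow_one, Nat.cast_one, add_sub_cancel_right] at this
      refine ⟨⟨N w, this⟩, ?_⟩
      simp only [LinearMap.domRestrict_apply]
      rw [← Module.End.mul_apply, ← pow_succ]
  have h5 : Module.finrank ℂ (LinearMap.ker ((N ^ (k + 1)).domRestrict (I p q))) =
      Module.finrank ℂ (primitivePart I N k p q) := by
    rw [LinearMap.ker_domRestrict, ← Submodule.finrank_map_subtype_eq,
      Submodule.map_comap_subtype, primitivePart]
  rw [h3, finrank_bot] at h2
  rw [h4, h5] at h1
  omega

/-- The hermitian symmetry of the polarization on a primitive subspace. -/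
theorem conj_form (h : IsRSplitPMHS n σ Q I N) (hσ : ∀ v, σ (σ v) = v)
    (hQreal : ∀ u v, Q (σ u) (σ v) = starRingEnd ℂ (Q u v)) (j : ℕ) (m : ℤ) (u v : W) :
    starRingEnd ℂ (Complex.I ^ m * Q u ((N ^ j) (σ v))) =
      Complex.I ^ (-m) * Q (σ u) ((N ^ j) v) := by
  rw [map_mul, ← hQreal, ← h.pow_map_conj, hσ, map_zpow₀, Complex.conj_I, ← Complex.inv_I,
    inv_zpow']

theorem form_hermitian (h : IsRSplitPMHS n σ Q I N) (hσ : ∀ v, σ (σ v) = v)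
    (hQreal : ∀ u v, Q (σ u) (σ v) = starRingEnd ℂ (Q u v))
    (hQ : ∀ u v, Q u v = (-1) ^ n * Q v u) {k : ℕ} {p q : ℤ} (hk : p + q = n + k) (u v : W) :
    starRingEnd ℂ (Complex.I ^ (p - q) * Q u ((N ^ k) (σ v))) =
      Complex.I ^ (p - q) * Q v ((N ^ k) (σ u)) := by
  rw [h.conj_form hσ hQreal, hQ, h.form_pow_map, ← mul_assoc, ← mul_assoc]
  congr 1
  have h1 : ((-1 : ℂ)) = Complex.I ^ (2 : ℤ) := by
    rw [zpow_ofNat, Complex.I_sq]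
  have h2 : ((-1 : ℂ)) ^ n * (-1) ^ k = (-1) ^ (p - q) := by
    rw [← zpow_natCast, ← zpow_add₀ (by norm_num), ← hk,
      show p + q = (p - q) + 2 * q by ring, zpow_add₀ (by norm_num), zpow_mul]
    norm_num
  rw [mul_assoc, h2, h1, ← zpow_mul, ← zpow_add₀ Complex.I_ne_zero]
  congr 1
  ring

/-- A primitive subspace has a basis that is unitary for its polarization. -/
theorem exists_unitary_family [FiniteDimensional ℂ W] (h : IsRSplitPMHS n σ Q I N)
    (hσ : ∀ v, σ (σ v) = v)
    (hQreal : ∀ u v, Q (σ u) (σ v) = starRingEnd ℂ (Q u v))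
    (hQ : ∀ u v, Q u v = (-1) ^ n * Q v u) {k : ℕ} {p q : ℤ} (hk : p + q = n + k) :
    ∃ e : Fin (Module.finrank ℂ (primitivePart I N k p q)) → W,
      Submodule.span ℂ (Set.range e) = primitivePart I N k p q ∧
      ∀ a b, Complex.I ^ (p - q) * Q (e a) ((N ^ k) (σ (e b))) = if a = b then 1 else 0 := by
  let c : InnerProductSpace.Core ℂ (primitivePart I N k p q) :=
    { inner := fun u v => Complex.I ^ (p - q) * Q v ((N ^ k) (σ u))
      conj_inner_symm := fun u v => h.form_hermitian hσ hQreal hQ hk _ _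
      re_inner_nonneg := fun u => by
        by_cases hu : (u : W) = 0
        · simp [hu]
        · obtain ⟨r, hr, he⟩ := h.exists_form_pos hk u.2 hu
          simp only [he]
          simpa using hr.le
      add_left := fun u v w => by simp [mul_add]
      smul_left := fun u v r => by simp; ring
      definite := fun u h0 => by
        by_contra hu
        obtain ⟨r, hr, he⟩ := h.exists_form_pos hk u.2 (fun h => hu (Subtype.ext h))
        rw [he] at h0
        exact hr.ne' (by exact_mod_cast h0) }
  obtain ⟨e, he, heq⟩ := c.exists_orthonormal
  refine ⟨fun a => e a, ?_, fun a b => ?_⟩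
  · have := congrArg (Submodule.map (primitivePart I N k p q).subtype) he
    rwa [Submodule.map_span, ← Set.range_comp, Submodule.map_subtype_top] at this
  · have : Complex.I ^ (p - q) * Q (e a) ((N ^ k) (σ (e b))) = if b = a then 1 else 0 :=
      heq b a
    simp only [this, eq_comm (a := b)]

/-- On a diagonal primitive subspace the unitary basis can be chosen real. -/
theorem exists_real_unitary_family [FiniteDimensional ℂ W] (h : IsRSplitPMHS n σ Q I N)
    (hσ : ∀ v, σ (σ v) = v)
    (hQreal : ∀ u v, Q (σ u) (σ v) = starRingEnd ℂ (Q u v))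
    (hQ : ∀ u v, Q u v = (-1) ^ n * Q v u) {k : ℕ} {p : ℤ} (hk : p + p = n + k) :
    ∃ e : Fin (Module.finrank ℂ (primitivePart I N k p p)) → W,
      Submodule.span ℂ (Set.range e) = primitivePart I N k p p ∧ (∀ a, σ (e a) = e a) ∧
      ∀ a b, Q (e a) ((N ^ k) (σ (e b))) = if a = b then 1 else 0 := by
  let P := primitivePart I N k p p
  let R : Submodule ℝ W :=
    { carrier := {v | v ∈ P ∧ σ v = v}
      add_mem' := fun {u v} hu hv => ⟨add_mem hu.1 hv.1, by rw [map_add, hu.2, hv.2]⟩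
      zero_mem' := ⟨zero_mem _, map_zero _⟩
      smul_mem' := fun r v hv => ⟨by
          rw [← Complex.coe_smul]; exact P.smul_mem _ hv.1, by
          rw [← Complex.coe_smul, LinearMap.map_smulₛₗ, hv.2, Complex.conj_ofReal]⟩ }
  have hreal : ∀ u v : R, (((Q u ((N ^ k) v)).re : ℝ) : ℂ) = Q u ((N ^ k) v) := by
    intro u v
    rw [← Complex.conj_eq_iff_re, ← hQreal, ← h.pow_map_conj, u.2.2, v.2.2]
  have hpos : ∀ u : R, u ≠ 0 → 0 < (Q u ((N ^ k) u)).re := by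
    intro u hu
    obtain ⟨r, hr, he⟩ := h.exists_form_pos hk u.2.1 (fun h => hu (Subtype.ext h))
    rw [sub_self, zpow_zero, one_mul, u.2.2] at he
    rw [he]
    exact hr
  have hsymm : ∀ u v : R, Q u ((N ^ k) v) = Q v ((N ^ k) u) := by
    intro u v
    have := h.form_hermitian hσ hQreal hQ hk u v
    rw [sub_self, zpow_zero, one_mul, one_mul, u.2.2, v.2.2, ← hreal, Complex.conj_ofReal,
      hreal] at this
    exact this
  let c : InnerProductSpace.Core ℝ R :=
    { inner := fun u v => (Q v ((N ^ k) u)).re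
      conj_inner_symm := fun u v => by simp [hsymm u v]
      re_inner_nonneg := fun u => by
        by_cases hu : u = 0
        · simp [hu]
        · exact (hpos u hu).le
      add_left := fun u v w => by simp
      smul_left := fun u v r => by
        simp [← Complex.coe_smul]
      definite := fun u h0 => by
        by_contra hu
        exact (hpos u hu).ne' h0 }
  obtain ⟨e, he, heq⟩ := c.exists_orthonormal
  have hort : ∀ a b, Q (e a) ((N ^ k) (e b)) = if a = b then 1 else 0 := by
    intro a b
    rw [← hreal]
    have : (Q (e a) ((N ^ k) (e b))).re = if b = a then 1 else 0 := heq b a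
    simp only [this, eq_comm (a := b)]
    split_ifs <;> simp
  have hRspan : ∀ v : W, v ∈ R → v ∈ Submodule.span ℂ (Set.range fun a => (e a : W)) := by
    intro v hv
    have h1 : (⟨v, hv⟩ : R) ∈ Submodule.span ℝ (Set.range e) := he ▸ trivial
    have h2 := Submodule.mem_map_of_mem (f := R.subtype) h1
    rw [Submodule.map_span, ← Set.range_comp] at h2
    exact Submodule.span_le_restrictScalars ℝ ℂ _ h2
  have hspan : Submodule.span ℂ (Set.range fun a => (e a : W)) = P := by
    apply le_antisymm
    · rw [Submodule.span_le]
      rintro _ ⟨a, rfl⟩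
      exact (e a).2.1
    · intro v hv
      have hv' := h.conj_mem_primitivePart hv
      have h1 : v + σ v ∈ R := ⟨add_mem hv hv', by rw [map_add, hσ, add_comm]⟩
      have h2 : Complex.I • (v - σ v) ∈ R := ⟨P.smul_mem _ (sub_mem hv hv'), by
        rw [LinearMap.map_smulₛₗ, map_sub, hσ, Complex.conj_I, neg_smul, ← smul_neg, neg_sub]⟩
      have h3 : v = (1 / 2 : ℂ) • (v + σ v) +
          (-Complex.I / 2) • (Complex.I • (v - σ v)) := by
        rw [smul_smul, show -Complex.I / 2 * Complex.I = 1 / 2 by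
          rw [div_mul_eq_mul_div, neg_mul, Complex.I_mul_I, neg_neg]]
        module
      rw [h3]
      exact add_mem (Submodule.smul_mem _ _ (hRspan _ h1))
        (Submodule.smul_mem _ _ (hRspan _ h2))
  have hli : LinearIndependent ℂ (fun a => (e a : W)) := by
    rw [Fintype.linearIndependent_iff]
    intro g hg b
    have := congrArg (fun v => Q v ((N ^ k) (e b))) hg
    simpa [hort] using this
  have hcard := finrank_span_eq_card hli
  rw [hspan, Fintype.card_fin] at hcard
  refine ⟨fun a => e (Fin.cast hcard a), ?_, fun a => (e _).2.2, fun a b => ?_⟩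
  · refine Eq.trans ?_ hspan
    congr 1
    exact (finCongr hcard).surjective.range_comp (fun a => (e a : W))
  · rw [(e _).2.2, hort]
    simp

/-- `f` enumerates a basis of the primitive subspace of type `(p, q)`, of length `m` and padded
by zeros, that is unitary for the polarization. Below the middle weight `f` vanishes. -/
structure IsUnitaryFamily (n : ℤ) (σ : W →ₛₗ[starRingEnd ℂ] W) (Q : W →ₗ[ℂ] W →ₗ[ℂ] ℂ)
    (I : ℤ → ℤ → Submodule ℂ W) (N : W →ₗ[ℂ] W) (p q : ℤ) (m : ℕ) (f : ℕ → W) : Prop where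
  eq_zero : p + q < n → ∀ a, f a = 0
  span_eq : ∀ k : ℕ, p + q = n + k → Submodule.span ℂ (Set.range f) = primitivePart I N k p q
  form_eq : ∀ k : ℕ, p + q = n + k → ∀ a b,
    Complex.I ^ (p - q) * Q (f a) ((N ^ k) (σ (f b))) = if a = b ∧ a < m then 1 else 0

/-- Padding a finite unitary basis of a primitive subspace by zeros. -/
theorem isUnitaryFamily_extend {k m : ℕ} {p q : ℤ} (hk : p + q = n + k) (e : Fin m → W)
    (hspan : Submodule.span ℂ (Set.range e) = primitivePart I N k p q)
    (hform : ∀ a b, Complex.I ^ (p - q) * Q (e a) ((N ^ k) (σ (e b))) = if a = b then 1 else 0) :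
    IsUnitaryFamily n σ Q I N p q m (fun a => if h : a < m then e ⟨a, h⟩ else 0) where
  eq_zero := by omega
  span_eq k' hk' := by
    obtain rfl : k = k' := by omega
    rw [← hspan]
    apply le_antisymm <;> rw [Submodule.span_le]
    · rintro _ ⟨a, rfl⟩
      dsimp only
      split_ifs with h
      · exact Submodule.subset_span ⟨_, rfl⟩
      · exact zero_mem _
    · rintro _ ⟨a, rfl⟩
      refine Submodule.subset_span ⟨a, ?_⟩
      simp
  form_eq k' hk' a b := by
    obtain rfl : k = k' := by omega
    by_cases ha : a < m
    · by_cases hb : b < m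
      · simp [ha, hb, hform]
      · have : a ≠ b := by omega
        simp [hb, this]
    · simp [ha]

theorem IsUnitaryFamily.mem {k : ℕ} {p q : ℤ} {m : ℕ} {f : ℕ → W}
    (hf : IsUnitaryFamily n σ Q I N p q m f) (hk : p + q = n + k) (a : ℕ) :
    f a ∈ primitivePart I N k p q := by
  rw [← hf.span_eq k hk]
  exact Submodule.subset_span ⟨a, rfl⟩

theorem IsUnitaryFamily.mem_bigraded {p q : ℤ} {m : ℕ} {f : ℕ → W}
    (hf : IsUnitaryFamily n σ Q I N p q m f) (a : ℕ) : f a ∈ I p q := by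
  by_cases hpq : p + q < n
  · rw [hf.eq_zero hpq]
    exact zero_mem _
  · exact (hf.mem (k := (p + q - n).toNat) (by omega) a).1

theorem IsUnitaryFamily.conj (h : IsRSplitPMHS n σ Q I N) (hσ : ∀ v, σ (σ v) = v)
    (hQreal : ∀ u v, Q (σ u) (σ v) = starRingEnd ℂ (Q u v)) {p q : ℤ} {m : ℕ} {f : ℕ → W}
    (hf : IsUnitaryFamily n σ Q I N p q m f) :
    IsUnitaryFamily n σ Q I N q p m (fun a => σ (f a)) where
  eq_zero hpq a := by rw [hf.eq_zero (by omega), map_zero]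
  span_eq k hk := by
    have hk' : p + q = n + k := by omega
    apply le_antisymm
    · rw [Submodule.span_le]
      rintro _ ⟨a, rfl⟩
      exact h.conj_mem_primitivePart (hf.mem hk' a)
    · intro v hv
      have h1 := h.conj_mem_primitivePart hv
      rw [← hf.span_eq k hk'] at h1
      have h2 := Submodule.mem_map_of_mem (f := σ) h1
      rwa [hσ, Submodule.map_span, ← Set.range_comp] at h2
  form_eq k hk a b := by
    have h1 := h.conj_form hσ hQreal k (p - q) (f a) (f b)
    rw [neg_sub] at h1
    rw [hσ, ← h1, hf.form_eq k (by omega)]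
    split_ifs <;> simp

/-- Every ℝ-split PMHS has unitary bases of its primitive subspaces, compatible with
conjugation, whose lengths depend on the Hodge diamond `δ` only. -/
theorem exists_unitaryFamilies [FiniteDimensional ℂ W] (h : IsRSplitPMHS n σ Q I N)
    (hσ : ∀ v, σ (σ v) = v)
    (hQreal : ∀ u v, Q (σ u) (σ v) = starRingEnd ℂ (Q u v))
    (hQ : ∀ u v, Q u v = (-1) ^ n * Q v u) (δ : ℤ → ℤ → ℕ)
    (hδ : ∀ p q, Module.finrank ℂ (I p q) = δ p q) :
    ∃ e : ℤ → ℤ → ℕ → W, (∀ p q a, σ (e p q a) = e q p a) ∧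
      ∀ p q, IsUnitaryFamily n σ Q I N p q
        (δ (min p q) (max p q) - δ (min p q + 1) (max p q + 1)) (e p q) := by
  have hex : ∀ p q, ∃ f : ℕ → W, (p = q → ∀ a, σ (f a) = f a) ∧
      IsUnitaryFamily n σ Q I N p q (δ p q - δ (p + 1) (q + 1)) f := by
    intro p q
    by_cases hpq : p + q < n
    · exact ⟨fun _ => 0, by simp, by simp, by omega, by omega⟩
    · obtain ⟨k, hk⟩ : ∃ k : ℕ, p + q = n + k := ⟨(p + q - n).toNat, by omega⟩
      have hm : Module.finrank ℂ (primitivePart I N k p q) = δ p q - δ (p + 1) (q + 1) := by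
        have := h.finrank_primitivePart_add hk
        rw [hδ, hδ] at this
        omega
      rw [← hm]
      by_cases hd : p = q
      · subst hd
        obtain ⟨e, hspan, hreal, hform⟩ := h.exists_real_unitary_family hσ hQreal hQ hk
        refine ⟨_, fun _ a => ?_, isUnitaryFamily_extend hk e hspan (by simpa using hform)⟩
        split_ifs
        · exact hreal _
        · exact map_zero _
      · obtain ⟨e, hspan, hform⟩ := h.exists_unitary_family hσ hQreal hQ hk
        exact ⟨_, fun h => absurd h hd, isUnitaryFamily_extend hk e hspan hform⟩
  choose f hreal hf using hex
  refine ⟨fun p q => if p ≤ q then f p q else fun a => σ (f q p a), fun p q a => ?_,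
    fun p q => ?_⟩
  · rcases lt_trichotomy p q with hpq | rfl | hpq
    · simp [hpq.le, hpq.not_ge]
    · simpa using hreal p p rfl a
    · simp [hpq.le, hpq.not_ge, hσ]
  · by_cases hpq : p ≤ q
    · simpa [hpq] using hf p q
    · have hqp : q ≤ p := by omega
      simpa [hpq, hqp] using (hf q p).conj h hσ hQreal

/-- The Lefschetz decomposition: `I p q` is spanned by the images under powers of `N` of
spanning families of the primitive subspaces. -/
theorem le_span_pow_map (h : IsRSplitPMHS n σ Q I N) (e : ℤ → ℤ → ℕ → W)
    (he : ∀ (k : ℕ) (p q : ℤ), p + q = n + k →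
      primitivePart I N k p q ≤ Submodule.span ℂ (Set.range (e p q))) (p q : ℤ) :
    I p q ≤ Submodule.span ℂ
      (Set.range fun x : ℕ × ℕ => (N ^ x.1) (e (p + x.1) (q + x.1) x.2)) := by
  set L : ℤ → ℤ → Submodule ℂ W := fun p q => Submodule.span ℂ
      (Set.range fun x : ℕ × ℕ => (N ^ x.1) (e (p + x.1) (q + x.1) x.2)) with hL
  have hmap : ∀ (j : ℕ) (p q : ℤ) (v : W), v ∈ L (p + j) (q + j) → (N ^ j) v ∈ L p q := by
    intro j p q v hv
    refine (Submodule.span_le.mpr ?_ : L (p + j) (q + j) ≤ (L p q).comap (N ^ j)) hv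
    rintro _ ⟨⟨i, a⟩, rfl⟩
    refine Submodule.subset_span ⟨(j + i, a), ?_⟩
    simp only [Nat.cast_add, add_assoc, pow_add, Module.End.mul_apply]
  have hprim : ∀ (k : ℕ) (p q : ℤ), p + q = n + k → primitivePart I N k p q ≤ L p q := by
    intro k p q hk
    refine (he k p q hk).trans (Submodule.span_mono ?_)
    rintro _ ⟨a, rfl⟩
    exact ⟨(0, a), by simp⟩
  have hupper : ∀ (i k : ℕ) (p q : ℤ) (u : W), p + q = n + k → u ∈ I p q →
      (N ^ (k + 1 + i)) u = 0 → u ∈ L p q := by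
    intro i
    induction i with
    | zero => exact fun k p q u hk hu h0 => hprim k p q hk ⟨hu, h0⟩
    | succ i ih =>
      intro k p q u hk hu h0
      obtain ⟨w, hw, hwu, hprimw⟩ := h.exists_sub_mem_primitivePart hk hu
      have hw0 : (N ^ (k + 2 + 1 + i)) w = 0 := by
        rw [show k + 2 + 1 + i = (i + 1) + (k + 2) by ring, pow_add, Module.End.mul_apply, hwu,
          ← Module.End.mul_apply, ← pow_add, show i + 1 + (k + 1) = k + 1 + (i + 1) by ring, h0]
      have hwL := ih (k + 2) (p + 1) (q + 1) w (by push_cast; linarith) hw hw0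
      have := hmap 1 p q w (by simpa using hwL)
      rw [pow_one] at this
      simpa using add_mem (hprim k p q hk hprimw) this
  obtain ⟨m, hm⟩ := h.exists_pow_eq_zero
  have hupper' : ∀ (k : ℕ) (p q : ℤ) (u : W), p + q = n + k → u ∈ I p q → u ∈ L p q :=
    fun k p q u hk hu => hupper m k p q u hk hu (by rw [pow_add, Module.End.mul_apply, hm, map_zero])
  intro u hu
  rcases le_total n (p + q) with hpq | hpq
  · exact hupper' (p + q - n).toNat p q u (by omega) hu
  · obtain ⟨k, hk⟩ : ∃ k : ℕ, p + q + k = n := ⟨(n - (p + q)).toNat, by omega⟩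
    have hk' : p + k + (q + k) = n + k := by omega
    obtain ⟨w, hw, rfl⟩ := h.exists_pow_eq hk' (v := u) (by simpa using hu)
    exact hmap k p q w (hupper' k _ _ w hk' hw)

/-- The Gram matrix of the basis obtained by applying powers of `N` to unitary bases of the
primitive subspaces. -/
theorem form_pow_map_unitaryFamilies (h : IsRSplitPMHS n σ Q I N) {m : ℤ → ℤ → ℕ}
    {e : ℤ → ℤ → ℕ → W} (hconj : ∀ p q a, σ (e p q a) = e q p a)
    (he : ∀ p q, IsUnitaryFamily n σ Q I N p q (m p q) (e p q)) (p q r s : ℤ) (a b i j : ℕ) :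
    Q ((N ^ i) (e p q a)) ((N ^ j) (e r s b)) =
      if n ≤ p + q ∧ r = q ∧ s = p ∧ (i : ℤ) + j = p + q - n ∧ a = b ∧ a < m p q then
        (-1) ^ i * Complex.I ^ (-(p - q)) else 0 := by
  by_cases hpq : p + q < n
  · rw [(he p q).eq_zero hpq, if_neg (by omega)]
    simp
  by_cases hrs : r + s < n
  · rw [(he r s).eq_zero hrs, if_neg (by omega)]
    simp
  obtain ⟨k, hk⟩ : ∃ k : ℕ, p + q = n + k := ⟨(p + q - n).toNat, by omega⟩
  obtain ⟨l, hl⟩ : ∃ l : ℕ, r + s = n + l := ⟨(r + s - n).toNat, by omega⟩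
  have hvan : ∀ {k t : ℕ} {p q : ℤ} (a : ℕ), p + q = n + k → k < t → (N ^ t) (e p q a) = 0 := by
    intro k t p q a hk hkt
    have h0 : (N ^ (k + 1)) (e p q a) = 0 := ((he p q).mem hk a).2
    rw [show t = (t - (k + 1)) + (k + 1) by omega, pow_add, Module.End.mul_apply, h0, map_zero]
  rw [h.form_pow_map, ← Module.End.mul_apply, ← pow_add]
  by_cases hdeg : p + (r - (i + j : ℕ)) ≠ n ∨ q + (s - (i + j : ℕ)) ≠ n
  · rw [h.form_eq_zero hdeg ((he p q).mem_bigraded a)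
      (h.pow_map_mem _ ((he r s).mem_bigraded b)), if_neg (by push_cast at hdeg; omega), mul_zero]
  push Not at hdeg
  push_cast at hdeg
  by_cases hlt : l < i + j
  · rw [hvan b hl hlt, if_neg (by omega), map_zero, mul_zero]
  by_cases hkt : k < i + j
  · have h1 := h.form_pow_map (i + j) (e p q a) (e r s b)
    rw [hvan a hk hkt, map_zero, LinearMap.zero_apply] at h1
    rw [(mul_eq_zero.mp h1.symm).resolve_left (by simp), if_neg (by omega), mul_zero]
  obtain rfl : r = q := by omega
  obtain rfl : s = p := by omega
  obtain rfl : k = i + j := by omega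
  have h1 := (he s r).form_eq _ hk a b
  rw [hconj] at h1
  have h2 : Q (e s r a) ((N ^ (i + j)) (e r s b)) =
      Complex.I ^ (-(s - r)) * if a = b ∧ a < m s r then 1 else 0 := by
    rw [← h1, ← mul_assoc, ← zpow_add₀ Complex.I_ne_zero, neg_add_cancel, zpow_zero, one_mul]
  rw [h2]
  by_cases hab : a = b ∧ a < m s r
  · rw [if_pos hab, if_pos (by push_cast at hk; omega), mul_one]
  · rw [if_neg hab, if_neg (by tauto), mul_zero, mul_zero]

/-- ℝ-split PMHS with the same Hodge diamond are conjugate. -/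
theorem exists_conjugating_isometry [FiniteDimensional ℂ W] {I' : ℤ → ℤ → Submodule ℂ W}
    {N' : W →ₗ[ℂ] W} (h : IsRSplitPMHS n σ Q I N) (h' : IsRSplitPMHS n σ Q I' N')
    (hσ : ∀ v, σ (σ v) = v)
    (hQreal : ∀ u v, Q (σ u) (σ v) = starRingEnd ℂ (Q u v))
    (hQnondeg : ∀ u, (∀ v, Q u v = 0) → u = 0)
    (hQ : ∀ u v, Q u v = (-1) ^ n * Q v u)
    (hdim : ∀ p q : ℤ, Module.finrank ℂ (I p q) = Module.finrank ℂ (I' p q)) :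
    ∃ g : W ≃ₗ[ℂ] W, (∀ v, g (σ v) = σ (g v)) ∧ (∀ u v, Q (g u) (g v) = Q u v) ∧
      (∀ p q : ℤ, Submodule.map (g : W →ₗ[ℂ] W) (I p q) = I' p q) ∧
      (∀ v, g (N v) = N' (g v)) := by
  obtain ⟨e, hconj, he⟩ := h.exists_unitaryFamilies hσ hQreal hQ _ fun _ _ => rfl
  obtain ⟨e', hconj', he'⟩ := h'.exists_unitaryFamilies hσ hQreal hQ _ fun p q => (hdim p q).symm
  have hle := h.le_span_pow_map e fun k p q hk => ((he p q).span_eq k hk).ge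
  have hle' := h'.le_span_pow_map e' fun k p q hk => ((he' p q).span_eq k hk).ge
  let b : ℤ × ℤ × ℕ × ℕ → W := fun x => (N ^ x.2.2.2) (e x.1 x.2.1 x.2.2.1)
  let b' : ℤ × ℤ × ℕ × ℕ → W := fun x => (N' ^ x.2.2.2) (e' x.1 x.2.1 x.2.2.1)
  have hb : Submodule.span ℂ (Set.range b) = ⊤ := by
    rw [eq_top_iff, ← h.iSup_eq_top]
    refine iSup_le fun pq => (hle pq.1 pq.2).trans (Submodule.span_mono ?_)
    rintro _ ⟨⟨j, a⟩, rfl⟩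
    exact ⟨(pq.1 + j, pq.2 + j, a, j), rfl⟩
  have hb' : Submodule.span ℂ (Set.range b') = ⊤ := by
    rw [eq_top_iff, ← h'.iSup_eq_top]
    refine iSup_le fun pq => (hle' pq.1 pq.2).trans (Submodule.span_mono ?_)
    rintro _ ⟨⟨j, a⟩, rfl⟩
    exact ⟨(pq.1 + j, pq.2 + j, a, j), rfl⟩
  obtain ⟨g, hg, hgQ⟩ := exists_isometry_of_gram_eq Q hQnondeg b b' hb hb' fun x y => by
    simp only [b, b', h.form_pow_map_unitaryFamilies hconj he,
      h'.form_pow_map_unitaryFamilies hconj' he']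
  have hg' : ∀ p q a j, g ((N ^ j) (e p q a)) = (N' ^ j) (e' p q a) :=
    fun p q a j => hg (p, q, a, j)
  refine ⟨g, fun v => ?_, hgQ, fun p q => ?_, fun v => ?_⟩
  · have hv : v ∈ Submodule.span ℂ (Set.range b) := hb ▸ trivial
    induction hv using Submodule.span_induction with
    | mem x hx =>
      obtain ⟨⟨p, q, a, j⟩, rfl⟩ := hx
      simp only [b, ← h.pow_map_conj, hconj, hg', ← h'.pow_map_conj, hconj']
    | zero => simp
    | add x y _ _ hx hy => simp [hx, hy]
    | smul c x _ hx => simp [hx]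
  · apply Submodule.eq_of_le_of_finrank_eq
    · rw [Submodule.map_le_iff_le_comap]
      refine (hle p q).trans (Submodule.span_le.mpr ?_)
      rintro _ ⟨⟨j, a⟩, rfl⟩
      have := h'.pow_map_mem j ((he' (p + j) (q + j)).mem_bigraded a)
      simpa [hg'] using this
    · rw [← hdim]
      exact LinearEquiv.finrank_map_eq g _
  · have hv : v ∈ Submodule.span ℂ (Set.range b) := hb ▸ trivial
    induction hv using Submodule.span_induction with
    | mem x hx =>
      obtain ⟨⟨p, q, a, j⟩, rfl⟩ := hx
      simp only [b, hg', ← Module.End.mul_apply, ← pow_succ']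
    | zero => simp
    | add x y _ _ hx hy => simp [hx, hy]
    | smul c x _ hx => simp [hx]

end

end IsRSplitPMHS

/-- **Hodge diamonds classify `Aut(V,Q)`-conjugacy classes of ℝ-split PMHS.**
With `(V,Q)` encoded as a finite-dimensional complex vector space `W` with conjugation
`σ` and compatible nondegenerate form `Q` (symmetric for even `n`, alternating for odd
`n`), two ℝ-split polarized mixed Hodge structures `(I₁,N₁)` and `(I₂,N₂)` of weight `n`
have equal Hodge diamonds if and only if they are conjugate under `Aut(V,Q)`, i.e. there
is a `Q`-preserving, conjugation-commuting linear automorphism `g` with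
`g(I₁^{p,q}) = I₂^{p,q}` and `g N₁ g⁻¹ = N₂`. -/
theorem stmt3 {W : Type*} [AddCommGroup W] [Module ℂ W] [FiniteDimensional ℂ W]
    (n : ℕ)
    (σ : W →ₛₗ[starRingEnd ℂ] W) (hσ : ∀ v, σ (σ v) = v)
    (Q : W →ₗ[ℂ] W →ₗ[ℂ] ℂ)
    (hQreal : ∀ u v, Q (σ u) (σ v) = starRingEnd ℂ (Q u v))
    (hQnondeg : ∀ u, (∀ v, Q u v = 0) → u = 0)
    (hQsym : Even n → ∀ u v, Q u v = Q v u)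
    (hQalt : Odd n → ∀ u v, Q u v = - Q v u)
    (I₁ I₂ : ℤ → ℤ → Submodule ℂ W) (N₁ N₂ : W →ₗ[ℂ] W)
    (h₁ : IsRSplitPMHS (n : ℤ) σ Q I₁ N₁)
    (h₂ : IsRSplitPMHS (n : ℤ) σ Q I₂ N₂) :
    (∀ p q : ℤ, Module.finrank ℂ (I₁ p q) = Module.finrank ℂ (I₂ p q)) ↔
      ∃ g : W ≃ₗ[ℂ] W,
        (∀ v, g (σ v) = σ (g v)) ∧
        (∀ u v, Q (g u) (g v) = Q u v) ∧
        (∀ p q : ℤ, Submodule.map (g : W →ₗ[ℂ] W) (I₁ p q) = I₂ p q) ∧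
        (∀ v, g (N₁ v) = N₂ (g v)) := by
  have hQ : ∀ u v, Q u v = (-1) ^ (n : ℤ) * Q v u := by
    intro u v
    rcases Nat.even_or_odd n with hn | hn
    · rw [zpow_natCast, hn.neg_one_pow, one_mul, hQsym hn]
    · rw [zpow_natCast, hn.neg_one_pow, neg_one_mul, hQalt hn]
  constructor
  · exact h₁.exists_conjugating_isometry h₂ hσ hQreal hQnondeg hQ
  · rintro ⟨g, -, -, hg, -⟩ p q
    rw [← hg]
    exact (LinearEquiv.finrank_map_eq g _).symm
end

section
/- Let n ≥ 0 and let V be a finite-dimensional real vector space with a nondegenerate bilinear form Q that is symmetric if n is even and alternating if n is odd. Two ℝ-split polarized mixed Hodge structures (I₁,N₁) and (I₂,N₂) of weight n on (V,Q) are conjugate under Aut(V,Q) if and only if they have equal primitive Hodge–Deligne numbers, i.e. dim_ℂ (ker(N₁^{p+q−n+1}) ∩ I₁^{p,q}) = dim_ℂ (ker(N₂^{p+q−n+1}) ∩ I₂^{p,q}) for all p,q with p+q ≥ n. -/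
/-- A Hermitian positive definite form on a finite-dimensional space has an orthonormal basis. -/
theorem exists_basis_of_hermitian_posDef {𝕜 E : Type*} [RCLike 𝕜] [AddCommGroup E] [Module 𝕜 E]
    [FiniteDimensional 𝕜 E] (h : E → E → 𝕜)
    (hsymm : ∀ u v, starRingEnd 𝕜 (h u v) = h v u)
    (hadd : ∀ u v w, h (u + v) w = h u w + h v w)
    (hsmul : ∀ (c : 𝕜) u v, h (c • u) v = c * h u v)
    (hpos : ∀ u, u ≠ 0 → 0 < RCLike.re (h u u)) :
    ∃ b : Module.Basis (Fin (Module.finrank 𝕜 E)) 𝕜 E,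
      ∀ i j, h (b i) (b j) = if i = j then 1 else 0 := by
  have h0 : ∀ v, h 0 v = 0 := fun v => by simpa using hsmul 0 0 v
  let core : InnerProductSpace.Core 𝕜 E :=
    { inner := fun u v => h v u
      conj_inner_symm := fun u v => hsymm u v
      re_inner_nonneg := fun u => by
        by_cases hu : u = 0
        · simp [hu, h0]
        · exact (hpos u hu).le
      add_left := fun u v w => by
        rw [← hsymm, hadd, map_add, hsymm, hsymm]
      smul_left := fun u v c => by
        rw [← hsymm, hsmul, map_mul, hsymm]
      definite := fun u hu => by
        by_contra hne
        have := hpos u hne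
        change h u u = 0 at hu
        simp [hu] at this }
  let : NormedAddCommGroup E := core.toNormedAddCommGroup
  let : InnerProductSpace 𝕜 E := InnerProductSpace.ofCore core.toCore
  refine ⟨(stdOrthonormalBasis 𝕜 E).toBasis, fun i j => ?_⟩
  have := orthonormal_iff_ite.mp (stdOrthonormalBasis 𝕜 E).orthonormal j i
  simp only [OrthonormalBasis.coe_toBasis]
  simp only [eq_comm (a := i)]
  exact this

/-- A sesquilinear form whose diagonal values on a subspace are real is Hermitian there. -/
theorem hermitian_of_diagonal_real {W : Type*} [AddCommGroup W] [Module ℂ W]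
    (h : W →ₗ[ℂ] W →ₛₗ[starRingEnd ℂ] ℂ) (P : Submodule ℂ W)
    (hreal : ∀ u ∈ P, (h u u).im = 0) {u v : W} (hu : u ∈ P) (hv : v ∈ P) :
    starRingEnd ℂ (h u v) = h v u := by
  have h1 := hreal _ (P.add_mem hu hv)
  have h2 := hreal _ (P.add_mem hu (P.smul_mem Complex.I hv))
  have hu0 := hreal _ hu
  have hv0 := hreal _ hv
  simp at h1 h2
  apply Complex.ext <;> simp <;> linarith

/-- A unitary frame of a subspace on which a sesquilinear form is positive definite. -/
theorem exists_unitary_frame {W : Type*} [AddCommGroup W] [Module ℂ W] [FiniteDimensional ℂ W]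
    (h : W →ₗ[ℂ] W →ₛₗ[starRingEnd ℂ] ℂ) (P : Submodule ℂ W)
    (hpos : ∀ u ∈ P, u ≠ 0 → ∃ r : ℝ, 0 < r ∧ h u u = r) :
    ∃ e : Fin (Module.finrank ℂ P) → W, Submodule.span ℂ (Set.range e) = P ∧
      ∀ i j, h (e i) (e j) = if i = j then 1 else 0 := by
  have hreal : ∀ u ∈ P, (h u u).im = 0 := by
    intro u hu
    by_cases h0 : u = 0
    · simp [h0]
    · obtain ⟨r, -, hr⟩ := hpos u hu h0
      simp [hr]
  obtain ⟨b, hb⟩ := exists_basis_of_hermitian_posDef (𝕜 := ℂ) (E := P) (fun u v => h u v)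
    (fun u v => hermitian_of_diagonal_real h P hreal u.2 v.2)
    (fun u v w => by simp) (fun c u v => by simp)
    (fun u hu => by
      obtain ⟨r, hr0, hr⟩ := hpos u u.2 (by simpa using hu)
      simp only [hr]
      simpa using hr0)
  refine ⟨fun i => b i, ?_, hb⟩
  have := b.span_eq
  have h2 : Set.range (fun i => (b i : W)) = P.subtype '' Set.range b := by
    rw [← Set.range_comp]; rfl
  rw [h2, Submodule.span_image, this, Submodule.map_top, Submodule.range_subtype]

/-- If the subspace is stable under a conjugation compatible with the form, the frame can be
chosen to consist of real vectors. -/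
theorem exists_real_unitary_frame {W : Type*} [AddCommGroup W] [Module ℂ W]
    [FiniteDimensional ℂ W]
    (σ : W →ₛₗ[starRingEnd ℂ] W) (hσ : ∀ v, σ (σ v) = v)
    (h : W →ₗ[ℂ] W →ₛₗ[starRingEnd ℂ] ℂ) (P : Submodule ℂ W)
    (hP : ∀ u ∈ P, σ u ∈ P)
    (hconj : ∀ u v, h (σ u) (σ v) = starRingEnd ℂ (h u v))
    (hpos : ∀ u ∈ P, u ≠ 0 → ∃ r : ℝ, 0 < r ∧ h u u = r) :
    ∃ e : Fin (Module.finrank ℂ P) → W, Submodule.span ℂ (Set.range e) = P ∧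
      (∀ i j, h (e i) (e j) = if i = j then 1 else 0) ∧ ∀ i, σ (e i) = e i := by
  have hreal : ∀ u ∈ P, (h u u).im = 0 := by
    intro u hu
    by_cases h0 : u = 0
    · simp [h0]
    · obtain ⟨r, -, hr⟩ := hpos u hu h0
      simp [hr]
  have hsm : ∀ (r : ℝ) (v : W), r • v = (r : ℂ) • v := fun r v => rfl
  let E : Submodule ℝ W :=
    { carrier := {v | v ∈ P ∧ σ v = v}
      add_mem' := fun {u v} hu hv => ⟨P.add_mem hu.1 hv.1, by simp [hu.2, hv.2]⟩
      zero_mem' := ⟨P.zero_mem, by simp⟩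
      smul_mem' := fun r v hv => ⟨P.smul_mem (r : ℂ) hv.1, by
        rw [hsm, map_smulₛₗ, hv.2, Complex.conj_ofReal]⟩ }
  have : FiniteDimensional ℝ W := FiniteDimensional.complexToReal W
  have him : ∀ u v : E, ((h u v).re : ℂ) = h u v := by
    intro u v
    have := hconj u v
    rw [u.2.2, v.2.2] at this
    exact (Complex.conj_eq_iff_re.mp this.symm)
  obtain ⟨b, hb⟩ := exists_basis_of_hermitian_posDef (𝕜 := ℝ) (E := E) (fun u v => (h u v).re)
    (fun u v => by
      have := hermitian_of_diagonal_real h P hreal u.2.1 v.2.1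
      simp [← this])
    (fun u v w => by simp)
    (fun c u v => by
      change (h ((c : ℂ) • (u : W)) v).re = c * (h u v).re
      simp)
    (fun u hu => by
      obtain ⟨r, hr0, hr⟩ := hpos u u.2.1 (by simpa using hu)
      simp only [hr]
      simpa using hr0)
  have horth : ∀ i j, h (b i) (b j) = if i = j then 1 else 0 := by
    intro i j
    rw [← him, hb]
    split_ifs <;> simp
  have hli : LinearIndependent ℂ (fun i => (b i : W)) := by
    rw [Fintype.linearIndependent_iff]
    intro c hc i
    have : h (∑ j, c j • (b j : W)) (b i) = 0 := by rw [hc]; simp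
    simpa [LinearMap.sum_apply, horth] using this
  have hE : ∀ v, v ∈ E → v ∈ Submodule.span ℂ (Set.range fun i => (b i : W)) := by
    intro v hv
    have h1 : (⟨v, hv⟩ : E) ∈ Submodule.span ℝ (Set.range b) := by simp [b.span_eq]
    have h2 : v ∈ (Submodule.span ℝ (Set.range b)).map E.subtype := ⟨_, h1, rfl⟩
    rw [← Submodule.span_image, ← Set.range_comp] at h2
    exact Submodule.span_le_restrictScalars ℝ ℂ _ h2
  have hspan : Submodule.span ℂ (Set.range fun i => (b i : W)) = P := by
    apply le_antisymm
    · rw [Submodule.span_le]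
      rintro _ ⟨i, rfl⟩
      exact (b i).2.1
    · intro u hu
      have h1 : u + σ u ∈ E := ⟨P.add_mem hu (hP u hu), by rw [map_add, hσ, add_comm]⟩
      have h2 : Complex.I • (u - σ u) ∈ E :=
        ⟨P.smul_mem _ (P.sub_mem hu (hP u hu)), by
          rw [map_smulₛₗ, map_sub, hσ, Complex.conj_I, neg_smul, ← smul_neg, neg_sub]⟩
      have : u = (1 / 2 : ℂ) • (u + σ u) + (-Complex.I / 2) • (Complex.I • (u - σ u)) := by
        rw [smul_smul, show -Complex.I / 2 * Complex.I = 1 / 2 by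
          rw [div_mul_eq_mul_div, neg_mul, Complex.I_mul_I, neg_neg]]
        module
      rw [this]
      exact Submodule.add_mem _ (Submodule.smul_mem _ _ (hE _ h1))
        (Submodule.smul_mem _ _ (hE _ h2))
  have hcard : Module.finrank ℝ E = Module.finrank ℂ P := by
    have := finrank_span_eq_card hli
    rw [hspan, Fintype.card_fin] at this
    exact this.symm
  refine ⟨fun i => b (Fin.cast hcard.symm i), ?_, fun i j => ?_, fun i => (b _).2.2⟩
  · refine Eq.trans ?_ hspan
    congr 1
    exact (finCongr hcard.symm).surjective.range_comp fun i => (b i : W)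
  · rw [horth]
    simp

/-- The sesquilinear form `(u, v) ↦ i^m Q(u, T (σ v))`. -/
noncomputable def twistedForm {W : Type*} [AddCommGroup W] [Module ℂ W]
    (σ : W →ₛₗ[starRingEnd ℂ] W) (Q : W →ₗ[ℂ] W →ₗ[ℂ] ℂ) (T : W →ₗ[ℂ] W) (m : ℤ) :
    W →ₗ[ℂ] W →ₛₗ[starRingEnd ℂ] ℂ :=
  LinearMap.mk₂'ₛₗ (RingHom.id ℂ) (starRingEnd ℂ) (fun u v => Complex.I ^ m * Q u (T (σ v)))
    (fun u v w => by simp [mul_add]) (fun c u v => by simp; ring)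
    (fun u v w => by simp [mul_add]) (fun c u v => by simp; ring)

theorem conj_I_zpow (m : ℤ) : starRingEnd ℂ (Complex.I ^ m) = Complex.I ^ (-m) := by
  rw [map_zpow₀, Complex.conj_I, ← Complex.inv_I, inv_zpow, zpow_neg]

/-- The powers of a real endomorphism are real. -/
theorem pow_apply_conj {W : Type*} [AddCommGroup W] [Module ℂ W]
    {σ : W →ₛₗ[starRingEnd ℂ] W} {N : W →ₗ[ℂ] W} (hN : ∀ v, N (σ v) = σ (N v)) (k : ℕ) (v : W) :
    (N ^ k) (σ v) = σ ((N ^ k) v) := by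
  induction k with
  | zero => rfl
  | succ k ih => rw [pow_succ', Module.End.mul_apply, ih, hN, Module.End.mul_apply]

/-- Powers of an infinitesimal isometry are moved across the form. -/
theorem form_pow_apply {W : Type*} [AddCommGroup W] [Module ℂ W]
    {Q : W →ₗ[ℂ] W →ₗ[ℂ] ℂ} {N : W →ₗ[ℂ] W} (hN : ∀ u v, Q (N u) v + Q u (N v) = 0)
    (k : ℕ) (u v : W) : Q ((N ^ k) u) v = (-1) ^ k * Q u ((N ^ k) v) := by
  induction k generalizing v with
  | zero => simp
  | succ k ih =>
    rw [pow_succ', Module.End.mul_apply, eq_neg_of_add_eq_zero_left (hN _ v), ih,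
      ← Module.End.mul_apply, ← pow_succ, ← pow_succ']
    ring

/-- Every primitive subspace has a unitary frame, which is real on the diagonal. -/
theorem exists_primitive_frame {W : Type*} [AddCommGroup W] [Module ℂ W] [FiniteDimensional ℂ W]
    {n : ℤ} {σ : W →ₛₗ[starRingEnd ℂ] W} (hσ : ∀ v, σ (σ v) = v)
    {Q : W →ₗ[ℂ] W →ₗ[ℂ] ℂ}
    (hQreal : ∀ u v, Q (σ u) (σ v) = starRingEnd ℂ (Q u v))
    {I : ℤ → ℤ → Submodule ℂ W} {N : W →ₗ[ℂ] W} (hI : IsRSplitPMHS n σ Q I N)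
    (p q : ℤ) (k : ℕ) (hpq : p + q = n + k) :
    ∃ e : Fin (Module.finrank ℂ ↥(LinearMap.ker (N ^ (k + 1)) ⊓ I p q)) → W,
      Submodule.span ℂ (Set.range e) = LinearMap.ker (N ^ (k + 1)) ⊓ I p q ∧
      (∀ a b, Complex.I ^ (p - q) * Q (e a) ((N ^ k) (σ (e b))) = if a = b then 1 else 0) ∧
      (p = q → ∀ a, σ (e a) = e a) := by
  obtain ⟨-, -, -, -, hNσ, -, -, -, hIσ, -, -, -, hpos⟩ := hI
  have hNσ' : ∀ v, N (σ v) = σ (N v) := fun v => hNσ v trivial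
  have hp : ∀ u ∈ LinearMap.ker (N ^ (k + 1)) ⊓ I p q, u ≠ 0 →
      ∃ r : ℝ, 0 < r ∧ twistedForm σ Q (N ^ k) (p - q) u u = r :=
    fun u hu h0 => hpos k p q hpq u hu.2 hu.1 h0
  by_cases hdiag : p = q
  · subst hdiag
    obtain ⟨e, h1, h2, h3⟩ := exists_real_unitary_frame σ hσ
      (twistedForm σ Q (N ^ k) (p - p)) (LinearMap.ker (N ^ (k + 1)) ⊓ I p p)
      (fun u hu => ⟨by
        change (N ^ (k + 1)) (σ u) = 0
        rw [pow_apply_conj hNσ', LinearMap.mem_ker.mp hu.1, map_zero],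
        hIσ _ _ _ hu.2⟩)
      (fun u v => by
        simp only [twistedForm, LinearMap.mk₂'ₛₗ_apply, sub_self, zpow_zero, one_mul]
        rw [pow_apply_conj hNσ', hQreal])
      hp
    exact ⟨e, h1, h2, fun _ => h3⟩
  · obtain ⟨e, h1, h2⟩ := exists_unitary_frame (twistedForm σ Q (N ^ k) (p - q))
      (LinearMap.ker (N ^ (k + 1)) ⊓ I p q) hp
    exact ⟨e, h1, h2, fun h => absurd h hdiag⟩

/-- Primitive unitary frames can be chosen compatibly with conjugation. -/
theorem exists_conj_compatible_frames {W : Type*} [AddCommGroup W] [Module ℂ W]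
    [FiniteDimensional ℂ W]
    {n : ℤ} {σ : W →ₛₗ[starRingEnd ℂ] W} (hσ : ∀ v, σ (σ v) = v)
    {Q : W →ₗ[ℂ] W →ₗ[ℂ] ℂ}
    (hQreal : ∀ u v, Q (σ u) (σ v) = starRingEnd ℂ (Q u v))
    {I : ℤ → ℤ → Submodule ℂ W} {N : W →ₗ[ℂ] W} (hI : IsRSplitPMHS n σ Q I N)
    (d : ℤ → ℤ → ℕ)
    (hd : ∀ p q : ℤ, n ≤ p + q →
      Module.finrank ℂ ↥(LinearMap.ker (N ^ ((p + q - n).toNat + 1)) ⊓ I p q) = d p q) :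
    ∃ e : ℤ → ℤ → ℕ → W, ∀ (p q : ℤ) (k : ℕ), p + q = n + k →
      Submodule.span ℂ (e p q '' Set.Iio (d (max p q) (min p q))) =
        LinearMap.ker (N ^ (k + 1)) ⊓ I p q ∧
      (∀ a, σ (e p q a) = e q p a) ∧
      (∀ a b, a < d (max p q) (min p q) → b < d (max p q) (min p q) →
        Q (e p q a) ((N ^ k) (e q p b)) = if a = b then Complex.I ^ (q - p) else 0) := by
  have hNσ : ∀ v, N (σ v) = σ (N v) := fun v => hI.2.2.2.2.1 v trivial
  have hIσ := hI.2.2.2.2.2.2.2.2.1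
  have hf : ∀ p q : ℤ, ∃ f : ℕ → W, ∀ k : ℕ, p + q = n + k →
      Submodule.span ℂ (f '' Set.Iio (d p q)) = LinearMap.ker (N ^ (k + 1)) ⊓ I p q ∧
      (∀ a b, a < d p q → b < d p q →
        Complex.I ^ (p - q) * Q (f a) ((N ^ k) (σ (f b))) = if a = b then 1 else 0) ∧
      (p = q → ∀ a, σ (f a) = f a) := by
    intro p q
    by_cases hpq : n ≤ p + q
    · have hk : p + q = n + (p + q - n).toNat := by omega
      have hdim := hd p q hpq
      generalize (p + q - n).toNat = k at hk hdim
      have hframe := exists_primitive_frame hσ hQreal hI p q k hk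
      rw [hdim] at hframe
      obtain ⟨e, h1, h2, h3⟩ := hframe
      refine ⟨fun a => if h : a < d p q then e ⟨a, h⟩ else 0, fun k' hk' => ?_⟩
      obtain rfl : k' = k := by omega
      refine ⟨?_, fun a b ha hb => ?_, fun h a => ?_⟩
      · rw [← h1]
        congr 1
        ext v
        constructor
        · rintro ⟨a, ha, rfl⟩
          exact ⟨⟨a, ha⟩, by simp [Set.mem_Iio.mp ha]⟩
        · rintro ⟨a, rfl⟩
          exact ⟨a, a.2, by simp⟩
      · simp only [ha, hb, dif_pos, h2, Fin.mk.injEq]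
      · dsimp only
        split_ifs with ha
        · exact h3 h _
        · simp
    · exact ⟨0, fun k hk => by omega⟩
  choose f hf using hf
  refine ⟨fun p q a => if q ≤ p then f p q a else σ (f q p a), fun p q k hk => ?_⟩
  rcases lt_trichotomy q p with hlt | heq | hlt
  · obtain ⟨h1, h2, h3⟩ := hf p q k hk
    simp only [hlt.le, hlt.not_ge, if_true, if_false, max_eq_left, min_eq_right]
    refine ⟨h1, fun a => trivial, fun a b ha hb => ?_⟩
    have := h2 a b ha hb
    rw [← neg_sub p q, zpow_neg]
    have hne : Complex.I ^ (p - q) ≠ 0 := zpow_ne_zero _ Complex.I_ne_zero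
    split_ifs with hab
    · rw [if_pos hab] at this
      exact eq_inv_of_mul_eq_one_right this
    · rw [if_neg hab] at this
      exact (mul_eq_zero.mp this).resolve_left hne
  · subst heq
    obtain ⟨h1, h2, h3⟩ := hf q q k hk
    simp only [le_refl, if_true, max_self, min_self, sub_self, zpow_zero]
    refine ⟨h1, h3 rfl, fun a b ha hb => ?_⟩
    have := h2 a b ha hb
    rwa [h3 rfl, sub_self, zpow_zero, one_mul] at this
  · obtain ⟨h1, h2, h3⟩ := hf q p k (by omega)
    simp only [hlt.le, hlt.not_ge, if_true, if_false, max_eq_right, min_eq_left]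
    refine ⟨?_, fun a => hσ _, fun a b ha hb => ?_⟩
    · apply le_antisymm
      · rw [Submodule.span_le]
        rintro _ ⟨a, ha, rfl⟩
        have hm : f q p a ∈ LinearMap.ker (N ^ (k + 1)) ⊓ I q p :=
          h1 ▸ Submodule.subset_span ⟨a, ha, rfl⟩
        refine ⟨?_, hIσ _ _ _ hm.2⟩
        change (N ^ (k + 1)) (σ (f q p a)) = 0
        rw [pow_apply_conj hNσ, LinearMap.mem_ker.mp hm.1, map_zero]
      · rintro u ⟨hu1, hu2⟩
        have hm : σ u ∈ Submodule.span ℂ (f q p '' Set.Iio (d q p)) := by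
          rw [h1]
          refine ⟨?_, hIσ _ _ _ hu2⟩
          change (N ^ (k + 1)) (σ u) = 0
          rw [pow_apply_conj hNσ, LinearMap.mem_ker.mp hu1, map_zero]
        have hm' : σ (σ u) ∈ (Submodule.span ℂ (f q p '' Set.Iio (d q p))).map σ :=
          Submodule.mem_map_of_mem hm
        rwa [hσ, Submodule.map_span, ← Set.image_comp] at hm'
    · have := congrArg (starRingEnd ℂ) (h2 a b ha hb)
      rw [map_mul, conj_I_zpow, ← hQreal, ← pow_apply_conj hNσ, hσ] at this
      have hne : Complex.I ^ (-(q - p)) ≠ 0 := zpow_ne_zero _ Complex.I_ne_zero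
      split_ifs with hab
      · rw [if_pos hab, map_one, zpow_neg] at this
        rw [zpow_neg] at hne
        exact (eq_inv_of_mul_eq_one_right this).trans (inv_inv _)
      · rw [if_neg hab, map_zero] at this
        exact (mul_eq_zero.mp this).resolve_left hne

/-- `N ^ k` lowers both degrees by `k`. -/
theorem pow_apply_mem {W : Type*} [AddCommGroup W] [Module ℂ W]
    {I : ℤ → ℤ → Submodule ℂ W} {N : W →ₗ[ℂ] W}
    (hN : ∀ p q : ℤ, ∀ u ∈ I p q, N u ∈ I (p - 1) (q - 1))
    (k : ℕ) {p q : ℤ} {u : W} (hu : u ∈ I p q) : (N ^ k) u ∈ I (p - k) (q - k) := by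
  induction k with
  | zero => simpa using hu
  | succ k ih =>
    rw [pow_succ', Module.End.mul_apply]
    have := hN _ _ _ ih
    push_cast
    rwa [sub_sub, sub_sub] at this

/-- An `N`-stable subspace containing all primitive subspaces is everything. -/
theorem eq_top_of_primitive_le {W : Type*} [AddCommGroup W] [Module ℂ W]
    {n : ℤ} {σ : W →ₛₗ[starRingEnd ℂ] W} {Q : W →ₗ[ℂ] W →ₗ[ℂ] ℂ}
    {I : ℤ → ℤ → Submodule ℂ W} {N : W →ₗ[ℂ] W} (hI : IsRSplitPMHS n σ Q I N)
    (T : Submodule ℂ W) (hT : ∀ v ∈ T, N v ∈ T)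
    (hprim : ∀ (p q : ℤ) (k : ℕ), p + q = n + k → LinearMap.ker (N ^ (k + 1)) ⊓ I p q ≤ T) :
    T = ⊤ := by
  obtain ⟨⟨m, hm⟩, -, -, -, -, -, -, hsup, -, hN, -, hiso, -⟩ := hI
  have hTpow : ∀ (k : ℕ), ∀ u ∈ T, (N ^ k) u ∈ T := by
    intro k
    induction k with
    | zero => intro u hu; simpa using hu
    | succ k ih =>
      intro u hu
      rw [pow_succ', Module.End.mul_apply]
      exact hT _ (ih u hu)
  have hhigh : ∀ (r k : ℕ) (p q : ℤ), p + q = n + k → m ≤ k + r → I p q ≤ T := by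
    intro r
    induction r with
    | zero =>
      intro k p q hpq hk u hu
      have h0 : (N ^ k) u = 0 := by
        rw [show k = (k - m) + m by omega, pow_add, Module.End.mul_apply, hm u trivial, map_zero]
      rw [(hiso k p q hpq).1 u hu h0]
      exact T.zero_mem
    | succ r ih =>
      intro k p q hpq hk u hu
      have h1 := pow_apply_mem hN (k + 1) hu
      obtain ⟨w, hw, hwu⟩ := (hiso (k + 2) (p + 1) (q + 1) (by push_cast; omega)).2
        ((N ^ (k + 1)) u) (by
          convert h1 using 1
          congr 1 <;> · push_cast; ring)
      have hNw : N w ∈ I p q := by simpa using hN _ _ _ hw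
      have hwT : w ∈ T := ih (k + 2) (p + 1) (q + 1) (by push_cast; omega) (by omega) hw
      have hdiff : u - N w ∈ T := by
        refine hprim p q k hpq ⟨?_, (I p q).sub_mem hu hNw⟩
        change (N ^ (k + 1)) (u - N w) = 0
        rw [map_sub, ← Module.End.mul_apply, ← pow_succ, hwu, sub_self]
      simpa using T.add_mem hdiff (hT w hwT)
  rw [eq_top_iff, ← hsup, iSup_le_iff]
  rintro ⟨p, q⟩
  by_cases hpq : n ≤ p + q
  · exact hhigh m (p + q - n).toNat p q (by omega) (by omega)
  · intro v hv
    obtain ⟨k, hk⟩ : ∃ k : ℕ, p + q = n - k := ⟨(n - (p + q)).toNat, by omega⟩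
    obtain ⟨w, hw, rfl⟩ := (hiso k (p + k) (q + k) (by omega)).2 v (by simpa using hv)
    exact hTpow k w (hhigh m k (p + k) (q + k) (by omega) (by omega) hw)

/-- The index set of a Lefschetz basis: `a` numbers a primitive vector of type `(p, q)` and weight
`n + k`, and `j` is the power of `N` applied to it. -/
@[ext]
structure LefschetzIndex (n : ℤ) (d : ℤ → ℤ → ℕ) where
  p : ℤ
  q : ℤ
  k : ℕ
  j : ℕ
  a : ℕ
  weight : p + q = n + k
  j_le : j ≤ k
  a_lt : a < d (max p q) (min p q)

namespace LefschetzIndex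

variable {n : ℤ} {d : ℤ → ℤ → ℕ}

/-- The index of the complex conjugate vector. -/
def conj (x : LefschetzIndex n d) : LefschetzIndex n d where
  p := x.q
  q := x.p
  k := x.k
  j := x.j
  a := x.a
  weight := by rw [add_comm]; exact x.weight
  j_le := x.j_le
  a_lt := by rw [max_comm, min_comm]; exact x.a_lt

/-- The index of the vector that pairs nontrivially with the given one. -/
def dual (x : LefschetzIndex n d) : LefschetzIndex n d where
  p := x.q
  q := x.p
  k := x.k
  j := x.k - x.j
  a := x.a
  weight := by rw [add_comm]; exact x.weight
  j_le := Nat.sub_le _ _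
  a_lt := by rw [max_comm, min_comm]; exact x.a_lt

/-- The index of the image under `N`. -/
def next (x : LefschetzIndex n d) (hx : x.j < x.k) : LefschetzIndex n d where
  p := x.p
  q := x.q
  k := x.k
  j := x.j + 1
  a := x.a
  weight := x.weight
  j_le := hx
  a_lt := x.a_lt

/-- The value of the polarization on a basis vector and its dual. -/
noncomputable def pairing (x : LefschetzIndex n d) : ℂ := (-1) ^ x.j * Complex.I ^ (x.q - x.p)

theorem pairing_ne_zero (x : LefschetzIndex n d) : x.pairing ≠ 0 :=
  mul_ne_zero (pow_ne_zero _ (by norm_num)) (zpow_ne_zero _ Complex.I_ne_zero)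

theorem dual_dual (x : LefschetzIndex n d) : x.dual.dual = x := by
  ext <;> simp [dual, Nat.sub_sub_self x.j_le]

theorem eq_dual_comm {x y : LefschetzIndex n d} : x = y.dual ↔ y = x.dual :=
  ⟨fun h => h ▸ (dual_dual y).symm, fun h => h ▸ (dual_dual x).symm⟩

end LefschetzIndex

/-- A basis adapted to the bigrading, the conjugation, the form and `N`, in which all of these are
given by formulas depending only on the index. -/
structure IsLefschetzBasis {W : Type*} [AddCommGroup W] [Module ℂ W] {n : ℤ} {d : ℤ → ℤ → ℕ}
    (σ : W →ₛₗ[starRingEnd ℂ] W) (Q : W →ₗ[ℂ] W →ₗ[ℂ] ℂ)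
    (I : ℤ → ℤ → Submodule ℂ W) (N : W →ₗ[ℂ] W) (b : LefschetzIndex n d → W) : Prop where
  conj : ∀ x, σ (b x) = b x.conj
  next : ∀ x (hx : x.j < x.k), N (b x) = b (x.next hx)
  last : ∀ x, x.j = x.k → N (b x) = 0
  mem : ∀ x, b x ∈ I (x.p - x.j) (x.q - x.j)
  form_dual : ∀ x, Q (b x) (b x.dual) = x.pairing
  form_ne : ∀ x y, y ≠ x.dual → Q (b x) (b y) = 0
  span : Submodule.span ℂ (Set.range b) = ⊤

theorem exists_isLefschetzBasis {W : Type*} [AddCommGroup W] [Module ℂ W]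
    [FiniteDimensional ℂ W]
    {n : ℤ} {σ : W →ₛₗ[starRingEnd ℂ] W} (hσ : ∀ v, σ (σ v) = v)
    {Q : W →ₗ[ℂ] W →ₗ[ℂ] ℂ}
    (hQreal : ∀ u v, Q (σ u) (σ v) = starRingEnd ℂ (Q u v))
    {I : ℤ → ℤ → Submodule ℂ W} {N : W →ₗ[ℂ] W} (hI : IsRSplitPMHS n σ Q I N)
    (d : ℤ → ℤ → ℕ)
    (hd : ∀ p q : ℤ, n ≤ p + q →
      Module.finrank ℂ ↥(LinearMap.ker (N ^ ((p + q - n).toNat + 1)) ⊓ I p q) = d p q) :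
    ∃ b : LefschetzIndex n d → W, IsLefschetzBasis σ Q I N b := by
  obtain ⟨e, he⟩ := exists_conj_compatible_frames hσ hQreal hI d hd
  have hNσ : ∀ v, N (σ v) = σ (N v) := fun v => hI.2.2.2.2.1 v trivial
  have hNQ : ∀ u v, Q (N u) v + Q u (N v) = 0 := fun u v => hI.2.1 u trivial v trivial
  have hN := hI.2.2.2.2.2.2.2.2.2.1
  have horth := hI.2.2.2.2.2.2.2.2.2.2.1
  have hprim : ∀ x : LefschetzIndex n d,
      e x.p x.q x.a ∈ LinearMap.ker (N ^ (x.k + 1)) ⊓ I x.p x.q := fun x => by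
    rw [← (he x.p x.q x.k x.weight).1]
    exact Submodule.subset_span ⟨x.a, x.a_lt, rfl⟩
  have hzero : ∀ (x : LefschetzIndex n d) (i : ℕ), x.k < i → (N ^ i) (e x.p x.q x.a) = 0 := by
    intro x i hi
    rw [show i = (i - (x.k + 1)) + (x.k + 1) by omega, pow_add, Module.End.mul_apply,
      LinearMap.mem_ker.mp (hprim x).1, map_zero]
  let b : LefschetzIndex n d → W := fun x => (N ^ x.j) (e x.p x.q x.a)
  have hnext : ∀ x (hx : x.j < x.k), N (b x) = b (x.next hx) := fun x hx => by
    simp only [b, LefschetzIndex.next]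
    rw [pow_succ', Module.End.mul_apply]
  have hlast : ∀ x : LefschetzIndex n d, x.j = x.k → N (b x) = 0 := fun x hx => by
    simp only [b]
    rw [← Module.End.mul_apply, ← pow_succ', hzero x _ (by omega)]
  have hmem : ∀ x : LefschetzIndex n d, b x ∈ I (x.p - x.j) (x.q - x.j) :=
    fun x => pow_apply_mem hN _ (hprim x).2
  have hform : ∀ x y : LefschetzIndex n d,
      Q (b x) (b y) = (-1) ^ x.j * Q (e x.p x.q x.a) ((N ^ (x.j + y.j)) (e y.p y.q y.a)) := by
    intro x y
    simp only [b]
    rw [form_pow_apply hNQ, ← Module.End.mul_apply, ← pow_add]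
  refine ⟨b, ⟨fun x => ?_, hnext, hlast, hmem, fun x => ?_, fun x y hxy => ?_, ?_⟩⟩
  · simp only [b, LefschetzIndex.conj]
    rw [← pow_apply_conj hNσ, (he x.p x.q x.k x.weight).2.1]
  · rw [hform]
    simp only [LefschetzIndex.dual]
    rw [Nat.add_sub_cancel' x.j_le, (he x.p x.q x.k x.weight).2.2 _ _ x.a_lt x.a_lt, if_pos rfl]
    rfl
  · by_cases hdeg : (x.p - x.j) + (y.p - y.j) ≠ n ∨ (x.q - x.j) + (y.q - y.j) ≠ n
    · exact horth _ _ _ _ hdeg _ (hmem x) _ (hmem y)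
    rw [hform]
    by_cases hy : y.k < x.j + y.j
    · rw [hzero y _ hy, map_zero, mul_zero]
    by_cases hx : x.k < x.j + y.j
    · have h1 := form_pow_apply hNQ (x.j + y.j) (e x.p x.q x.a) (e y.p y.q y.a)
      rw [hzero x _ hx, map_zero, LinearMap.zero_apply] at h1
      rw [(mul_eq_zero.mp h1.symm).resolve_left (pow_ne_zero _ (by norm_num)), mul_zero]
    have hxw := x.weight
    have hyw := y.weight
    have hk : x.j + y.j = x.k := by omega
    have hyp : y.p = x.q := by omega
    have hyq : y.q = x.p := by omega
    have hyk : y.k = x.k := by omega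
    have hya := y.a_lt
    rw [hyp, hyq, max_comm, min_comm] at hya
    rw [hk, hyp, hyq, (he x.p x.q x.k x.weight).2.2 _ _ x.a_lt hya, if_neg, mul_zero]
    intro ha
    refine hxy (LefschetzIndex.ext hyp hyq hyk ?_ ha.symm)
    simp only [LefschetzIndex.dual]
    omega
  · refine eq_top_of_primitive_le hI _ (fun v hv => ?_) (fun p q k hpq => ?_)
    · have : Submodule.span ℂ (Set.range b) ≤ (Submodule.span ℂ (Set.range b)).comap N := by
        rw [Submodule.span_le]
        rintro _ ⟨x, rfl⟩
        change N (b x) ∈ Submodule.span ℂ (Set.range b)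
        rcases x.j_le.lt_or_eq with hx | hx
        · rw [hnext x hx]
          exact Submodule.subset_span ⟨_, rfl⟩
        · rw [hlast x hx]
          exact Submodule.zero_mem _
      exact this hv
    · rw [← (he p q k hpq).1]
      apply Submodule.span_mono
      rintro _ ⟨a, ha, rfl⟩
      exact ⟨⟨p, q, k, 0, a, hpq, Nat.zero_le _, ha⟩, rfl⟩

namespace IsLefschetzBasis

variable {W : Type*} [AddCommGroup W] [Module ℂ W] {n : ℤ} {d : ℤ → ℤ → ℕ}
  {σ : W →ₛₗ[starRingEnd ℂ] W} {Q : W →ₗ[ℂ] W →ₗ[ℂ] ℂ}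
  {I : ℤ → ℤ → Submodule ℂ W} {N : W →ₗ[ℂ] W} {b : LefschetzIndex n d → W}

/-- The coefficients of a combination are read off by pairing with the dual vectors. -/
theorem form_linearCombination (hb : IsLefschetzBasis σ Q I N b) (c : LefschetzIndex n d →₀ ℂ)
    (x : LefschetzIndex n d) :
    Q (Finsupp.linearCombination ℂ b c) (b x.dual) = c x * x.pairing := by
  rw [Finsupp.linearCombination_apply, Finsupp.sum, map_sum, LinearMap.sum_apply,
    Finset.sum_eq_single x]
  · simp [hb.form_dual]
  · intro y _ hyx
    rw [map_smul, LinearMap.smul_apply, hb.form_ne, smul_zero]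
    intro h
    apply hyx
    rw [← LefschetzIndex.dual_dual x, h, LefschetzIndex.dual_dual]
  · intro hx
    simp [Finsupp.notMem_support_iff.mp hx]

theorem linearIndependent (hb : IsLefschetzBasis σ Q I N b) : LinearIndependent ℂ b := by
  rw [linearIndependent_iff]
  intro c hc
  ext x
  have := hb.form_linearCombination c x
  rw [hc, map_zero, LinearMap.zero_apply] at this
  exact (mul_eq_zero.mp this.symm).resolve_right x.pairing_ne_zero

/-- The basis underlying a Lefschetz family. -/
noncomputable def toBasis (hb : IsLefschetzBasis σ Q I N b) :
    Module.Basis (LefschetzIndex n d) ℂ W :=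
  Module.Basis.mk hb.linearIndependent hb.span.ge

theorem toBasis_apply (hb : IsLefschetzBasis σ Q I N b) (x : LefschetzIndex n d) :
    hb.toBasis x = b x := Module.Basis.mk_apply _ _ x

/-- A vector of the bigraded piece `I p q` only involves basis vectors of that bidegree. -/
theorem repr_eq_zero (hb : IsLefschetzBasis σ Q I N b) (hI : IsRSplitPMHS n σ Q I N)
    {p q : ℤ} {u : W} (hu : u ∈ I p q) (x : LefschetzIndex n d)
    (hx : x.p - x.j ≠ p ∨ x.q - x.j ≠ q) : hb.toBasis.repr u x = 0 := by
  have h1 := hb.form_linearCombination (hb.toBasis.repr u) x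
  have h2 : Finsupp.linearCombination ℂ b (hb.toBasis.repr u) = u := by
    conv_rhs => rw [← hb.toBasis.linearCombination_repr u]
    congr 2
    funext y
    exact (hb.toBasis_apply y).symm
  have hw := x.weight
  have hj := x.j_le
  rw [h2, hI.2.2.2.2.2.2.2.2.2.2.1 _ _ _ _ _ _ hu _ (hb.mem x.dual)] at h1
  · exact (mul_eq_zero.mp h1.symm).resolve_right x.pairing_ne_zero
  · simp only [LefschetzIndex.dual]
    push_cast [hj]
    omega

variable {I' : ℤ → ℤ → Submodule ℂ W} {N' : W →ₗ[ℂ] W} {b' : LefschetzIndex n d → W}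

/-- The change of Lefschetz bases with the same index set. -/
noncomputable def equiv (hb : IsLefschetzBasis σ Q I N b) (hb' : IsLefschetzBasis σ Q I' N' b') :
    W ≃ₗ[ℂ] W :=
  hb.toBasis.equiv hb'.toBasis (Equiv.refl _)

theorem equiv_apply (hb : IsLefschetzBasis σ Q I N b) (hb' : IsLefschetzBasis σ Q I' N' b')
    (x : LefschetzIndex n d) : hb.equiv hb' (b x) = b' x := by
  rw [← hb.toBasis_apply, equiv, Module.Basis.equiv_apply, hb'.toBasis_apply]
  rfl

theorem equiv_symm (hb : IsLefschetzBasis σ Q I N b) (hb' : IsLefschetzBasis σ Q I' N' b') :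
    (hb.equiv hb').symm = hb'.equiv hb := by
  rw [equiv, Module.Basis.equiv_symm]
  rfl

theorem equiv_conj (hb : IsLefschetzBasis σ Q I N b) (hb' : IsLefschetzBasis σ Q I' N' b')
    (v : W) : hb.equiv hb' (σ v) = σ (hb.equiv hb' v) := by
  have : ((hb.equiv hb' : W →ₗ[ℂ] W).comp σ) = σ.comp (hb.equiv hb' : W →ₗ[ℂ] W) := by
    refine LinearMap.ext_on_range hb.span fun x => ?_
    simp [hb.conj, equiv_apply, hb'.conj]
  exact LinearMap.congr_fun this v

theorem equiv_comp (hb : IsLefschetzBasis σ Q I N b) (hb' : IsLefschetzBasis σ Q I' N' b')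
    (v : W) : hb.equiv hb' (N v) = N' (hb.equiv hb' v) := by
  have : ((hb.equiv hb' : W →ₗ[ℂ] W).comp N) = N'.comp (hb.equiv hb' : W →ₗ[ℂ] W) := by
    refine LinearMap.ext_on_range hb.span fun x => ?_
    rcases x.j_le.lt_or_eq with hx | hx
    · simp [hb.next x hx, equiv_apply, hb'.next x hx]
    · simp [hb.last x hx, equiv_apply, hb'.last x hx]
  exact LinearMap.congr_fun this v

theorem form_eq (hb : IsLefschetzBasis σ Q I N b) (hb' : IsLefschetzBasis σ Q I' N' b')
    (x y : LefschetzIndex n d) : Q (b' x) (b' y) = Q (b x) (b y) := by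
  by_cases h : y = x.dual
  · rw [h, hb.form_dual, hb'.form_dual]
  · rw [hb.form_ne x y h, hb'.form_ne x y h]

theorem form_equiv (hb : IsLefschetzBasis σ Q I N b) (hb' : IsLefschetzBasis σ Q I' N' b')
    (u v : W) : Q (hb.equiv hb' u) (hb.equiv hb' v) = Q u v := by
  have : Q.compl₁₂ (hb.equiv hb' : W →ₗ[ℂ] W) (hb.equiv hb' : W →ₗ[ℂ] W) = Q := by
    refine LinearMap.ext_on_range hb.span fun x => LinearMap.ext_on_range hb.span fun y => ?_
    simp [equiv_apply, form_eq hb hb']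
  exact LinearMap.congr_fun₂ this u v

theorem equiv_mem (hb : IsLefschetzBasis σ Q I N b) (hb' : IsLefschetzBasis σ Q I' N' b')
    (hI : IsRSplitPMHS n σ Q I N) {p q : ℤ} {u : W} (hu : u ∈ I p q) :
    hb.equiv hb' u ∈ I' p q := by
  rw [← hb.toBasis.linearCombination_repr u, Finsupp.linearCombination_apply, Finsupp.sum, map_sum]
  refine Submodule.sum_mem _ fun x hx => ?_
  rw [map_smul, hb.toBasis_apply, equiv_apply]
  refine Submodule.smul_mem _ _ ?_
  have h : x.p - x.j = p ∧ x.q - x.j = q := by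
    by_contra h
    exact Finsupp.mem_support_iff.mp hx (hb.repr_eq_zero hI hu x (by tauto))
  rw [← h.1, ← h.2]
  exact hb'.mem x

end IsLefschetzBasis

/-- **Primitive Hodge–Deligne numbers classify `Aut(V,Q)`-conjugacy classes of ℝ-split
PMHS.**  With `(V,Q)` encoded as a finite-dimensional complex vector space `W` with
conjugation `σ` and compatible nondegenerate form `Q` (symmetric for even `n`,
alternating for odd `n`), two ℝ-split polarized mixed Hodge structures `(I₁,N₁)` and
`(I₂,N₂)` of weight `n` are conjugate under `Aut(V,Q)` if and only if they have equal
primitive Hodge–Deligne numbers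
`dim_ℂ (ker(N^{p+q−n+1}) ∩ I^{p,q})` for all `p, q` with `p+q ≥ n`. -/
theorem stmt4 {W : Type*} [AddCommGroup W] [Module ℂ W] [FiniteDimensional ℂ W]
    (n : ℕ)
    (σ : W →ₛₗ[starRingEnd ℂ] W) (hσ : ∀ v, σ (σ v) = v)
    (Q : W →ₗ[ℂ] W →ₗ[ℂ] ℂ)
    (hQreal : ∀ u v, Q (σ u) (σ v) = starRingEnd ℂ (Q u v))
    (hQnondeg : ∀ u, (∀ v, Q u v = 0) → u = 0)
    (hQsym : Even n → ∀ u v, Q u v = Q v u)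
    (hQalt : Odd n → ∀ u v, Q u v = - Q v u)
    (I₁ I₂ : ℤ → ℤ → Submodule ℂ W) (N₁ N₂ : W →ₗ[ℂ] W)
    (h₁ : IsRSplitPMHS (n : ℤ) σ Q I₁ N₁)
    (h₂ : IsRSplitPMHS (n : ℤ) σ Q I₂ N₂) :
    (∃ g : W ≃ₗ[ℂ] W,
        (∀ v, g (σ v) = σ (g v)) ∧
        (∀ u v, Q (g u) (g v) = Q u v) ∧
        (∀ p q : ℤ, Submodule.map (g : W →ₗ[ℂ] W) (I₁ p q) = I₂ p q) ∧
        (∀ v, g (N₁ v) = N₂ (g v))) ↔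
      (∀ p q : ℤ, (n : ℤ) ≤ p + q →
        Module.finrank ℂ
            ↥(LinearMap.ker (N₁ ^ ((p + q - n).toNat + 1)) ⊓ I₁ p q) =
          Module.finrank ℂ
            ↥(LinearMap.ker (N₂ ^ ((p + q - n).toNat + 1)) ⊓ I₂ p q)) := by
  constructor
  · rintro ⟨g, -, -, hgI, hgN⟩ p q -
    have hpow : ∀ (k : ℕ) (v : W), g ((N₁ ^ k) v) = (N₂ ^ k) (g v) := by
      intro k
      induction k with
      | zero => intro v; rfl
      | succ k ih =>
        intro v
        rw [pow_succ, Module.End.mul_apply, ih, hgN, pow_succ, Module.End.mul_apply]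
    generalize (p + q - n).toNat + 1 = k
    have hmap : Submodule.map (g : W →ₗ[ℂ] W) (LinearMap.ker (N₁ ^ k) ⊓ I₁ p q) =
        LinearMap.ker (N₂ ^ k) ⊓ I₂ p q := by
      rw [Submodule.map_inf _ g.injective, hgI]
      congr 1
      ext v
      constructor
      · rintro ⟨u, hu, rfl⟩
        change (N₂ ^ k) (g u) = 0
        rw [← hpow, LinearMap.mem_ker.mp hu, map_zero]
      · intro hv
        refine ⟨g.symm v, ?_, g.apply_symm_apply v⟩
        apply g.injective
        rw [hpow, g.apply_symm_apply, map_zero]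
        exact hv
    rw [← hmap]
    exact (LinearEquiv.finrank_map_eq g _).symm
  · intro hdim
    obtain ⟨b₁, hb₁⟩ := exists_isLefschetzBasis hσ hQreal h₁ _ hdim
    obtain ⟨b₂, hb₂⟩ := exists_isLefschetzBasis hσ hQreal h₂ _ fun p q _ => rfl
    refine ⟨hb₁.equiv hb₂, hb₁.equiv_conj hb₂, hb₁.form_equiv hb₂, fun p q => ?_,
      hb₁.equiv_comp hb₂⟩
    apply le_antisymm
    · rintro _ ⟨u, hu, rfl⟩
      exact hb₁.equiv_mem hb₂ h₁ hu
    · intro v hv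
      refine ⟨hb₂.equiv hb₁ v, hb₂.equiv_mem hb₁ h₂ hv, ?_⟩
      rw [← hb₁.equiv_symm hb₂]
      exact (hb₁.equiv hb₂).apply_symm_apply v
end

section
/- Let n ≥ 0, let V be a finite-dimensional real vector space with a nondegenerate bilinear form Q that is symmetric if n is even and alternating if n is odd, and let (I,N) be an ℝ-split polarized mixed Hodge structure of weight n on (V,Q). For k ≥ 0 let P_{n+k} ⊆ V be the real primitive subspace of weight n+k (the real form of ⊕_{p+q=n+k} P^{p,q}), and let Q^N_k be the bilinear form Q^N_k(u,v) := Q(u, N^k v) on P_{n+k}. Then: (i) V = ⊕_{k ≥ 0} ⊕_{0 ≤ a ≤ k} N^a(P_{n+k}); (ii) each Q^N_k is nondegenerate on P_{n+k}, symmetric if n+k is even and alternating if n+k is odd; (iii) for every tuple (h_k)_k with h_k a real linear automorphism of P_{n+k} preserving Q^N_k, there is a unique g ∈ Aut(V,Q) with g∘N = N∘g and g(N^a v) = N^a h_k(v) for all v ∈ P_{n+k} and 0 ≤ a ≤ k; and (iv) the resulting map ∏_{k≥0} Aut(P_{n+k}, Q^N_k) → Aut(V,Q) is an injective group homomorphism.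 -/
/-- The real points (σ-fixed vectors) of a conjugation-stable complex subspace `S`. -/
def realIn {W : Type*} [AddCommGroup W] [Module ℂ W]
    (σ : W →ₛₗ[starRingEnd ℂ] W) (S : Submodule ℂ W) : Submodule ℝ W where
  carrier := {x | x ∈ S ∧ σ x = x}
  add_mem' := by
    rintro a b ⟨haS, haσ⟩ ⟨hbS, hbσ⟩
    exact ⟨S.add_mem haS hbS, by rw [map_add, haσ, hbσ]⟩
  zero_mem' := ⟨S.zero_mem, by simp⟩
  smul_mem' := by
    rintro r x ⟨hxS, hxσ⟩
    constructor
    · have h : r • x = (r : ℂ) • x := (Complex.coe_smul r x).symm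
      rw [h]; exact S.smul_mem _ hxS
    · have h : r • x = (r : ℂ) • x := (Complex.coe_smul r x).symm
      rw [h, map_smulₛₗ]
      simp [Complex.conj_ofReal, Complex.coe_smul, hxσ]

/-- The complex primitive subspace of weight `n + k`:
`⊕_{p+q = n+k} P^{p,q}` where `P^{p,q} = ker(N^{k+1}) ∩ I^{p,q}`. -/
noncomputable def primC {W : Type*} [AddCommGroup W] [Module ℂ W]
    (n : ℤ) (I : ℤ → ℤ → Submodule ℂ W) (N : W →ₗ[ℂ] W) (k : ℕ) :
    Submodule ℂ W :=
  ⨆ p : ℤ, (LinearMap.ker (N ^ (k + 1)) ⊓ I p (n + k - p))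

/-- The real primitive subspace `P_{n+k} ⊆ V` of weight `n + k`. -/
noncomputable def realPrim {W : Type*} [AddCommGroup W] [Module ℂ W]
    (n : ℤ) (σ : W →ₛₗ[starRingEnd ℂ] W) (I : ℤ → ℤ → Submodule ℂ W)
    (N : W →ₗ[ℂ] W) (k : ℕ) : Submodule ℝ W :=
  realIn σ (primC n I N k)

/-- The tuple of real linear automorphisms `(h_k)` of the real primitive subspaces
preserves each bilinear form `Q^N_k(u,v) = Q(u, N^k v)`. -/
def PreservesQk {W : Type*} [AddCommGroup W] [Module ℂ W]
    (n : ℤ) (σ : W →ₛₗ[starRingEnd ℂ] W) (Q : W →ₗ[ℂ] W →ₗ[ℂ] ℂ)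
    (I : ℤ → ℤ → Submodule ℂ W) (N : W →ₗ[ℂ] W)
    (h : ∀ k : ℕ, ↥(realPrim n σ I N k) ≃ₗ[ℝ] ↥(realPrim n σ I N k)) : Prop :=
  ∀ k : ℕ, ∀ u v : realPrim n σ I N k,
    Q ((h k u : W)) ((N ^ k) ((h k v : W))) = Q (u : W) ((N ^ k) (v : W))

/-- `g` is the element of `Aut(V,Q)` induced by the tuple `(h_k)`: it is real
(commutes with the conjugation `σ`), preserves `Q`, commutes with `N`, and satisfies
`g(N^a v) = N^a (h_k v)` for all `v ∈ P_{n+k}` and `0 ≤ a ≤ k`. -/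
def RealizesAut {W : Type*} [AddCommGroup W] [Module ℂ W]
    (n : ℤ) (σ : W →ₛₗ[starRingEnd ℂ] W) (Q : W →ₗ[ℂ] W →ₗ[ℂ] ℂ)
    (I : ℤ → ℤ → Submodule ℂ W) (N : W →ₗ[ℂ] W)
    (h : ∀ k : ℕ, ↥(realPrim n σ I N k) ≃ₗ[ℝ] ↥(realPrim n σ I N k))
    (g : W ≃ₗ[ℂ] W) : Prop :=
  (∀ v, g (σ v) = σ (g v)) ∧
  (∀ u v, Q (g u) (g v) = Q u v) ∧
  (∀ v, g (N v) = N (g v)) ∧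
  (∀ k : ℕ, ∀ a : ℕ, a ≤ k → ∀ v : realPrim n σ I N k,
      g ((N ^ a) (v : W)) = (N ^ a) ((h k v : W)))

section PrimitiveDecomposition

variable {W : Type*} [AddCommGroup W] [Module ℂ W]

/-- Every vector of a conjugation-stable subspace is `x + i y` with `x`, `y` real. -/
theorem exists_realIn_add_I_smul {σ : W →ₛₗ[starRingEnd ℂ] W} (hσ : ∀ v, σ (σ v) = v)
    {S : Submodule ℂ W} (hS : ∀ v ∈ S, σ v ∈ S) {u : W} (hu : u ∈ S) :
    ∃ x ∈ realIn σ S, ∃ y ∈ realIn σ S, u = x + Complex.I • y := by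
  refine ⟨(1 / 2 : ℂ) • (u + σ u), ⟨S.smul_mem _ (S.add_mem hu (hS u hu)), ?_⟩,
    (-Complex.I / 2) • (u - σ u), ⟨S.smul_mem _ (S.sub_mem hu (hS u hu)), ?_⟩, ?_⟩
  · simp [hσ, add_comm, Complex.conj_ofNat]
  · simp [hσ, smul_sub, neg_div, Complex.conj_ofNat]
    abel
  · rw [smul_smul, mul_div_assoc', mul_neg, Complex.I_mul_I, neg_neg, ← smul_add]
    rw [show u + σ u + (u - σ u) = (2 : ℂ) • u by rw [two_smul]; abel, smul_smul]
    norm_num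

/-- A real-linear map on the real points of a conjugation-stable subspace extends to a
complex-linear map on the subspace. -/
theorem exists_complexLinear_extension {σ : W →ₛₗ[starRingEnd ℂ] W} (hσ : ∀ v, σ (σ v) = v)
    {S : Submodule ℂ W} (hS : ∀ v ∈ S, σ v ∈ S) {W' : Type*} [AddCommGroup W'] [Module ℂ W']
    (f : realIn σ S →ₗ[ℝ] W') :
    ∃ F : S →ₗ[ℂ] W', ∀ x : realIn σ S, F ⟨x, x.2.1⟩ = f x := by
  have key : ∀ u : S, ∃ x y : realIn σ S, (u : W) = x + Complex.I • (y : W) := fun u => by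
    obtain ⟨x, hx, y, hy, h⟩ := exists_realIn_add_I_smul hσ hS u.2
    exact ⟨⟨x, hx⟩, ⟨y, hy⟩, h⟩
  have uniq : ∀ x y x' y' : realIn σ S,
      (x : W) + Complex.I • (y : W) = x' + Complex.I • (y' : W) → x = x' ∧ y = y' := by
    intro x y x' y' h
    have h2 := congrArg σ h
    simp only [map_add, map_smulₛₗ, x.2.2, y.2.2, x'.2.2, y'.2.2, Complex.conj_I] at h2
    have hx : (x : W) = x' := by
      have : (2 : ℂ) • (x : W) = (2 : ℂ) • (x' : W) := by
        linear_combination (norm := module) h + h2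
      exact smul_right_injective W (two_ne_zero (α := ℂ)) this
    refine ⟨Subtype.ext hx, Subtype.ext ?_⟩
    rw [hx] at h
    exact smul_right_injective W Complex.I_ne_zero (add_left_cancel h)
  choose re im hreim using key
  have hval : ∀ (u : S) (x y : realIn σ S), (u : W) = x + Complex.I • (y : W) →
      re u = x ∧ im u = y := fun u x y h => uniq _ _ _ _ ((hreim u).symm.trans h)
  refine ⟨{ toFun := fun u => f (re u) + Complex.I • f (im u), map_add' := ?_, map_smul' := ?_ }, ?_⟩
  · intro u v
    obtain ⟨h1, h2⟩ := hval (u + v) (re u + re v) (im u + im v) (by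
      push_cast
      rw [hreim u, hreim v, smul_add]; abel)
    simp only [h1, h2, map_add, smul_add]
    abel
  · intro c u
    obtain ⟨h1, h2⟩ := hval (c • u) (c.re • re u - c.im • im u) (c.re • im u + c.im • re u) (by
      push_cast
      rw [hreim u]
      nth_rewrite 1 [← Complex.re_add_im c]
      simp only [← Complex.coe_smul]
      match_scalars
      · ring
      · linear_combination (c.im : ℂ) * Complex.I_mul_I)
    simp only [h1, h2, map_add, map_sub, map_smul, RingHom.id_apply]
    nth_rewrite 5 [← Complex.re_add_im c]
    simp only [← Complex.coe_smul]
    match_scalars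
    · ring
    · linear_combination -(c.im : ℂ) * Complex.I_mul_I
  · intro x
    obtain ⟨h1, h2⟩ := hval ⟨x, x.2.1⟩ x 0 (by simp)
    simp [h1, h2]

variable {n : ℤ} {σ : W →ₛₗ[starRingEnd ℂ] W} {Q : W →ₗ[ℂ] W →ₗ[ℂ] ℂ}
  {I : ℤ → ℤ → Submodule ℂ W} {N : W →ₗ[ℂ] W}

theorem pow_skew (hskew : ∀ u v, Q (N u) v + Q u (N v) = 0) (a : ℕ) (u v : W) :
    Q ((N ^ a) u) v = (-1) ^ a * Q u ((N ^ a) v) := by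
  induction a generalizing v with
  | zero => simp
  | succ a ih =>
    rw [pow_succ' N, Module.End.mul_apply, eq_neg_of_add_eq_zero_left (hskew _ _), ih,
      ← Module.End.mul_apply, ← pow_succ, ← pow_succ' N]
    ring

theorem pow_mem_bigraded (hN : ∀ p q : ℤ, ∀ u ∈ I p q, N u ∈ I (p - 1) (q - 1)) (a : ℕ)
    {p q : ℤ} {u : W} (hu : u ∈ I p q) : (N ^ a) u ∈ I (p - a) (q - a) := by
  induction a with
  | zero => simpa using hu
  | succ a ih =>
    rw [pow_succ', Module.End.mul_apply]
    convert hN _ _ _ ih using 1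
    push_cast
    congr 1 <;> ring

theorem pow_eq_zero_of_mem_primC {k : ℕ} {u : W} (hu : u ∈ primC n I N k) {a : ℕ} (ha : k < a) :
    (N ^ a) u = 0 := by
  have h : primC n I N k ≤ LinearMap.ker (N ^ (k + 1)) := iSup_le fun p => inf_le_left
  obtain ⟨c, rfl⟩ := Nat.exists_eq_add_of_le' (Nat.succ_le_of_lt ha)
  rw [pow_add, Module.End.mul_apply, show (N ^ k.succ) u = 0 from h hu, map_zero]

theorem pow_conj (hσN : ∀ v, N (σ v) = σ (N v)) (a : ℕ) (v : W) :
    (N ^ a) (σ v) = σ ((N ^ a) v) := by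
  induction a with
  | zero => simp
  | succ a ih => rw [pow_succ', Module.End.mul_apply, ih, hσN, Module.End.mul_apply]

theorem primC_conj_mem (hσN : ∀ v, N (σ v) = σ (N v))
    (hσI : ∀ p q : ℤ, ∀ u ∈ I p q, σ u ∈ I q p) (k : ℕ) :
    ∀ v ∈ primC n I N k, σ v ∈ primC n I N k := by
  intro v hv
  have h : primC n I N k ≤ (primC n I N k).comap σ := by
    refine iSup_le fun p u hu => ?_
    refine Submodule.mem_iSup_of_mem (n + k - p) ⟨?_, ?_⟩
    · rw [SetLike.mem_coe, LinearMap.mem_ker, pow_conj hσN, LinearMap.mem_ker.1 hu.1, map_zero]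
    · simpa using hσI _ _ _ hu.2
  exact h hv

/-- The pieces `N^a P_{n+k}` and `N^b P_{n+l}` are `Q`-orthogonal unless `k = l = a + b`. -/
theorem form_pow_primC_eq_zero (hskew : ∀ u v, Q (N u) v + Q u (N v) = 0)
    (hN : ∀ p q : ℤ, ∀ u ∈ I p q, N u ∈ I (p - 1) (q - 1))
    (horth : ∀ p q r s : ℤ, p + r ≠ n ∨ q + s ≠ n → ∀ u ∈ I p q, ∀ v ∈ I r s, Q u v = 0)
    {k l a b : ℕ} (h : ¬ (k = l ∧ a + b = k)) {u v : W}
    (hu : u ∈ primC n I N k) (hv : v ∈ primC n I N l) :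
    Q ((N ^ a) u) ((N ^ b) v) = 0 := by
  rw [pow_skew hskew, ← Module.End.mul_apply, ← pow_add]
  by_cases hl : l < a + b
  · rw [pow_eq_zero_of_mem_primC hv hl, map_zero, mul_zero]
  by_cases hk : k < a + b
  · have := pow_skew hskew (a + b) u v
    rw [pow_eq_zero_of_mem_primC hu hk, map_zero, LinearMap.zero_apply] at this
    rw [(mul_eq_zero.1 this.symm).resolve_left (by simp), mul_zero]
  have h1 : ∀ p r : ℤ, ∀ u ∈ I p (n + k - p), ∀ v ∈ I r (n + l - r),
      Q u ((N ^ (a + b)) v) = 0 := fun p r u hu v hv => by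
    refine horth _ _ _ _ ?_ _ hu _ (pow_mem_bigraded hN (a + b) hv)
    push_cast
    omega
  have h2 : ∀ p : ℤ, ∀ u ∈ I p (n + k - p), Q u ((N ^ (a + b)) v) = 0 := fun p u hu => by
    have : primC n I N l ≤ LinearMap.ker ((Q u).comp (N ^ (a + b))) :=
      iSup_le fun r v hv => h1 p r u hu v hv.2
    exact this hv
  have : primC n I N k ≤ LinearMap.ker (Q.flip ((N ^ (a + b)) v)) :=
    iSup_le fun p u hu => h2 p u hu.2
  rw [show Q u ((N ^ (a + b)) v) = 0 from this hu, mul_zero]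

/-- The pieces `N^a P_{n+k}` of the complex primitive decomposition span. -/
theorem iSup_map_pow_primC_eq_top (hnil : ∃ m : ℕ, ∀ v, (N ^ m) v = 0)
    (htop : (⨆ pq : ℤ × ℤ, I pq.1 pq.2) = ⊤)
    (hN : ∀ p q : ℤ, ∀ u ∈ I p q, N u ∈ I (p - 1) (q - 1))
    (hiso : ∀ k : ℕ, ∀ p q : ℤ, p + q = n + k →
      (∀ u ∈ I p q, (N ^ k) u = 0 → u = 0) ∧
      (∀ v ∈ I (p - k) (q - k), ∃ u ∈ I p q, (N ^ k) u = v)) :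
    (⨆ x : Σ k : ℕ, Fin (k + 1), (primC n I N x.1).map (N ^ (x.2 : ℕ))) = ⊤ := by
  set T := ⨆ x : Σ k : ℕ, Fin (k + 1), (primC n I N x.1).map (N ^ (x.2 : ℕ))
  have hgen : ∀ (k a : ℕ), ∀ u ∈ primC n I N k, (N ^ a) u ∈ T := by
    intro k a u hu
    by_cases ha : k < a
    · rw [pow_eq_zero_of_mem_primC hu ha]
      exact T.zero_mem
    · exact Submodule.mem_iSup_of_mem (⟨k, ⟨a, by omega⟩⟩ : Σ k : ℕ, Fin (k + 1))
        (Submodule.mem_map_of_mem hu)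
  have hTN : ∀ v ∈ T, N v ∈ T := by
    have : T ≤ T.comap N := by
      refine iSup_le fun x => Submodule.map_le_iff_le_comap.2 fun u hu => ?_
      rw [Submodule.mem_comap, Submodule.mem_comap, ← Module.End.mul_apply, ← pow_succ']
      exact hgen _ _ _ hu
    exact fun v hv => this hv
  obtain ⟨m, hm⟩ := hnil
  have hpos : ∀ d j : ℕ, m ≤ j + d → ∀ p q : ℤ, p + q = n + j → I p q ≤ T := by
    intro d
    induction d with
    | zero =>
      intro j hj p q hpq u hu
      rw [(hiso j p q hpq).1 u hu]
      · exact T.zero_mem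
      · obtain ⟨c, rfl⟩ := Nat.exists_eq_add_of_le' hj
        simp only [add_zero] at *
        rw [pow_add, Module.End.mul_apply, hm, map_zero]
    | succ d ih =>
      intro j hj p q hpq v hv
      have hv' : (N ^ (j + 1)) v ∈ I (p + 1 - (j + 2 : ℕ)) (q + 1 - (j + 2 : ℕ)) := by
        convert pow_mem_bigraded hN (j + 1) hv using 1
        push_cast
        congr 1 <;> ring
      obtain ⟨w, hw, hwv⟩ := (hiso (j + 2) (p + 1) (q + 1) (by push_cast; omega)).2 _ hv'
      have hprim : v - N w ∈ primC n I N j := by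
        refine Submodule.mem_iSup_of_mem p ⟨?_, ?_⟩
        · rw [SetLike.mem_coe, LinearMap.mem_ker, map_sub, ← hwv, ← Module.End.mul_apply, ← pow_succ, sub_self]
        · rw [show n + j - p = q by omega]
          refine sub_mem hv ?_
          simpa using hN _ _ _ hw
      have hwT : w ∈ T := ih (j + 2) (by omega) (p + 1) (q + 1) (by push_cast; omega) hw
      have := T.add_mem (hgen j 0 _ hprim) (hTN w hwT)
      simpa using this
  rw [eq_top_iff, ← htop]
  refine iSup_le fun ⟨p, q⟩ => ?_
  rcases le_total n (p + q) with h | h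
  · obtain ⟨j, hj⟩ := Int.eq_ofNat_of_zero_le (sub_nonneg.2 h)
    exact hpos m j (by omega) p q (by omega)
  · obtain ⟨j, hj⟩ := Int.eq_ofNat_of_zero_le (sub_nonneg.2 h)
    intro v hv
    obtain ⟨u, hu, rfl⟩ := (hiso j (p + j) (q + j) (by omega)).2 v (by simpa using hv)
    have huT : u ∈ T := hpos m j (by omega) _ _ (by omega) hu
    have hpow : ∀ a : ℕ, (N ^ a) u ∈ T := by
      intro a
      induction a with
      | zero => simpa using huT
      | succ a ih => rw [pow_succ', Module.End.mul_apply]; exact hTN _ ih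
    exact hpow j

/-- The vectors `N^a v` with `v` real primitive of weight `n + k` and `a ≤ k` span `W` over `ℂ`. -/
theorem eq_top_of_pow_realPrim_mem (hσ : ∀ v, σ (σ v) = v)
    (hconj : ∀ k, ∀ v ∈ primC n I N k, σ v ∈ primC n I N k)
    (hspan : (⨆ x : Σ k : ℕ, Fin (k + 1), (primC n I N x.1).map (N ^ (x.2 : ℕ))) = ⊤)
    {T : Submodule ℂ W}
    (hT : ∀ k a : ℕ, a ≤ k → ∀ v ∈ realPrim n σ I N k, (N ^ a) v ∈ T) : T = ⊤ := by
  rw [eq_top_iff, ← hspan]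
  refine iSup_le fun ⟨k, a⟩ => Submodule.map_le_iff_le_comap.2 fun u hu => ?_
  obtain ⟨x, hx, y, hy, rfl⟩ := exists_realIn_add_I_smul hσ (hconj k) hu
  rw [Submodule.mem_comap, map_add, map_smul]
  exact T.add_mem (hT k a (by omega) x hx) (T.smul_mem _ (hT k a (by omega) y hy))

/-- Each form `Q(u, N^k v)` is nondegenerate on the primitive subspace of weight `n + k`. -/
theorem eq_zero_of_form_pow_primC_eq_zero (hQ : ∀ u, (∀ v, Q u v = 0) → u = 0)
    (hskew : ∀ u v, Q (N u) v + Q u (N v) = 0)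
    (hN : ∀ p q : ℤ, ∀ u ∈ I p q, N u ∈ I (p - 1) (q - 1))
    (horth : ∀ p q r s : ℤ, p + r ≠ n ∨ q + s ≠ n → ∀ u ∈ I p q, ∀ v ∈ I r s, Q u v = 0)
    (hspan : (⨆ x : Σ k : ℕ, Fin (k + 1), (primC n I N x.1).map (N ^ (x.2 : ℕ))) = ⊤)
    {k : ℕ} {u : W} (hu : u ∈ primC n I N k)
    (h : ∀ v ∈ primC n I N k, Q u ((N ^ k) v) = 0) : u = 0 := by
  have hker : LinearMap.ker (Q u) = ⊤ := by
    rw [eq_top_iff, ← hspan]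
    refine iSup_le fun ⟨l, b⟩ => Submodule.map_le_iff_le_comap.2 fun v hv => ?_
    by_cases hkl : k = l ∧ 0 + (b : ℕ) = k
    · obtain ⟨rfl, hb⟩ := hkl
      rw [zero_add] at hb
      simpa [hb] using h v hv
    · simpa using form_pow_primC_eq_zero hskew hN horth hkl hu hv
  exact hQ u fun v => by rw [← LinearMap.mem_ker, hker]; trivial

/-- The pieces `N^a P_{n+k}` of the complex primitive decomposition are independent. -/
theorem iSupIndep_map_pow_primC (hQ : ∀ u, (∀ v, Q u v = 0) → u = 0)
    (hskew : ∀ u v, Q (N u) v + Q u (N v) = 0)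
    (hN : ∀ p q : ℤ, ∀ u ∈ I p q, N u ∈ I (p - 1) (q - 1))
    (horth : ∀ p q r s : ℤ, p + r ≠ n ∨ q + s ≠ n → ∀ u ∈ I p q, ∀ v ∈ I r s, Q u v = 0)
    (hspan : (⨆ x : Σ k : ℕ, Fin (k + 1), (primC n I N x.1).map (N ^ (x.2 : ℕ))) = ⊤) :
    iSupIndep fun x : Σ k : ℕ, Fin (k + 1) => (primC n I N x.1).map (N ^ (x.2 : ℕ)) := by
  rintro ⟨k, a⟩
  rw [Submodule.disjoint_def]
  rintro _ ⟨u, hu, rfl⟩ hsup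
  suffices u = 0 by rw [this, map_zero]
  refine eq_zero_of_form_pow_primC_eq_zero hQ hskew hN horth hspan hu fun v hv => ?_
  have hle : (⨆ y : Σ k : ℕ, Fin (k + 1), ⨆ _ : y ≠ ⟨k, a⟩,
      (primC n I N y.1).map (N ^ (y.2 : ℕ))) ≤ LinearMap.ker (Q.flip ((N ^ (k - a : ℕ)) v)) := by
    refine iSup₂_le fun ⟨l, b⟩ hne => Submodule.map_le_iff_le_comap.2 fun w hw => ?_
    refine form_pow_primC_eq_zero hskew hN horth ?_ hw hv
    rintro ⟨hlk, hb⟩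
    obtain rfl : l = k := hlk
    have hb' : (b : ℕ) + (l - a) = l := hb
    exact hne (congrArg (Sigma.mk l) (Fin.ext (by omega)))
  have h0 : Q ((N ^ (a : ℕ)) u) ((N ^ (k - a : ℕ)) v) = 0 := hle hsup
  rw [pow_skew hskew, ← Module.End.mul_apply, ← pow_add,
    Nat.add_sub_cancel' (Nat.lt_succ_iff.1 a.2)] at h0
  exact (mul_eq_zero.1 h0).resolve_left (by simp)

/-- `N^a` is injective on the primitive subspace of weight `n + k` for `a ≤ k`. -/
theorem eq_zero_of_pow_primC_eq_zero (hQ : ∀ u, (∀ v, Q u v = 0) → u = 0)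
    (hskew : ∀ u v, Q (N u) v + Q u (N v) = 0)
    (hN : ∀ p q : ℤ, ∀ u ∈ I p q, N u ∈ I (p - 1) (q - 1))
    (horth : ∀ p q r s : ℤ, p + r ≠ n ∨ q + s ≠ n → ∀ u ∈ I p q, ∀ v ∈ I r s, Q u v = 0)
    (hspan : (⨆ x : Σ k : ℕ, Fin (k + 1), (primC n I N x.1).map (N ^ (x.2 : ℕ))) = ⊤)
    {k a : ℕ} (ha : a ≤ k) {u : W} (hu : u ∈ primC n I N k) (h : (N ^ a) u = 0) : u = 0 := by
  refine eq_zero_of_form_pow_primC_eq_zero hQ hskew hN horth hspan hu fun v _ => ?_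
  have hk : (N ^ k) u = 0 := by
    rw [← Nat.sub_add_cancel ha, pow_add, Module.End.mul_apply, h, map_zero]
  have := pow_skew hskew k u v
  rw [hk, map_zero, LinearMap.zero_apply] at this
  exact (mul_eq_zero.1 this.symm).resolve_left (by simp)

/-- Linear maps prescribed on the summands `P i` glue along injective maps `A i : P i → W` whose
images form a direct sum decomposition of `W`. -/
theorem exists_linearMap_of_iSupIndep_map {ι R M M' : Type*} [Ring R]
    [AddCommGroup M] [Module R M] [AddCommGroup M'] [Module R M']
    {P : ι → Submodule R M} {A : ι → M →ₗ[R] M}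
    (hA : ∀ i, ∀ u ∈ P i, A i u = 0 → u = 0)
    (hind : iSupIndep fun i => (P i).map (A i)) (htop : (⨆ i, (P i).map (A i)) = ⊤)
    (F : ∀ i, P i →ₗ[R] M') :
    ∃ G : M →ₗ[R] M', ∀ i, ∀ u : P i, G (A i u) = F i u := by
  classical
  let e := LinearEquiv.ofBijective
    (DirectSum.coeLinearMap fun i => (P i).map (A i))
    (DirectSum.isInternal_submodule_of_iSupIndep_of_iSup_eq_top hind htop)
  let E : ∀ i, P i ≃ₗ[R] (P i).map (A i) := fun i => LinearEquiv.ofBijective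
    ((A i).restrict (p := P i) (q := (P i).map (A i)) fun u hu =>
      Submodule.mem_map_of_mem hu) (by
      refine ⟨?_, ?_⟩
      · rw [injective_iff_map_eq_zero]
        exact fun u hu => Subtype.ext (hA i u u.2 (congrArg Subtype.val hu))
      · rintro ⟨_, u, hu, rfl⟩
        exact ⟨⟨u, hu⟩, rfl⟩)
  refine ⟨(DirectSum.toModule R ι M' fun i => F i ∘ₗ (E i).symm.toLinearMap) ∘ₗ
    e.symm.toLinearMap, fun i u => ?_⟩
  have : e.symm (A i u) = DirectSum.lof R ι (fun i => (P i).map (A i)) i (E i u) := by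
    rw [LinearEquiv.symm_apply_eq]
    exact (DirectSum.coeLinearMap_lof (fun i => (P i).map (A i)) i (E i u)).symm
  simp [this]

theorem iSupIndep_of_le_restrictScalars {ι M : Type*} [AddCommGroup M] [Module ℂ M]
    {A : ι → Submodule ℂ M} (hA : iSupIndep A) {B : ι → Submodule ℝ M}
    (hB : ∀ i, B i ≤ (A i).restrictScalars ℝ) : iSupIndep B := by
  intro i
  rw [Submodule.disjoint_def]
  intro x hx hsup
  refine (Submodule.disjoint_def.1 (hA i)) x (hB i hx) ?_
  have : (⨆ j, ⨆ _ : j ≠ i, B j) ≤ (⨆ j, ⨆ _ : j ≠ i, A j).restrictScalars ℝ :=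
    iSup₂_le fun j hj y hy => Submodule.mem_iSup_of_mem j (Submodule.mem_iSup_of_mem hj (hB j hy))
  exact this hsup

/-- The pieces `N^a P_{n+k}` of the real primitive decomposition span the real points. -/
theorem iSup_map_pow_realPrim (hσ : ∀ v, σ (σ v) = v) (hσN : ∀ v, N (σ v) = σ (N v))
    (hconj : ∀ k, ∀ v ∈ primC n I N k, σ v ∈ primC n I N k)
    (hspan : (⨆ x : Σ k : ℕ, Fin (k + 1), (primC n I N x.1).map (N ^ (x.2 : ℕ))) = ⊤) :
    (⨆ x : Σ k : ℕ, Fin (k + 1),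
      (realPrim n σ I N x.1).map ((N ^ (x.2 : ℕ)).restrictScalars ℝ)) = realIn σ ⊤ := by
  apply le_antisymm
  · refine iSup_le ?_
    rintro ⟨k, a⟩ _ ⟨u, hu, rfl⟩
    refine ⟨trivial, ?_⟩
    rw [LinearMap.restrictScalars_apply, ← pow_conj hσN, hu.2]
  · intro w hw
    set S := ⨆ x : Σ k : ℕ, Fin (k + 1),
      (realPrim n σ I N x.1).map ((N ^ (x.2 : ℕ)).restrictScalars ℝ)
    have key : ∀ v : W, v + σ v ∈ S := by
      intro v
      have hv : v ∈ ⨆ x : Σ k : ℕ, Fin (k + 1), (primC n I N x.1).map (N ^ (x.2 : ℕ)) := by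
        rw [hspan]; trivial
      induction hv using Submodule.iSup_induction' with
      | mem x v hv =>
        obtain ⟨u, hu, rfl⟩ := hv
        refine Submodule.mem_iSup_of_mem x ⟨u + σ u, ⟨?_, ?_⟩, ?_⟩
        · exact Submodule.add_mem _ hu (hconj _ _ hu)
        · rw [map_add, hσ, add_comm]
        · simp [pow_conj hσN]
      | zero => simp
      | add v v' _ _ hv hv' =>
        rw [map_add, add_add_add_comm]
        exact S.add_mem hv hv'
    have := S.smul_mem (1 / 2 : ℝ) (key w)
    rwa [hw.2, ← two_smul ℝ w, smul_smul, one_div, inv_mul_cancel₀ two_ne_zero, one_smul] at this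

end PrimitiveDecomposition

/-- **Primitive decomposition and the embedding `∏_k Aut(P_{n+k}, Q^N_k) ↪ Aut(V,Q)`.**
Let `(I,N)` be an ℝ-split PMHS of weight `n` on `(V,Q)` (encoded via `(W,σ,Q)`).  Then:
(i) `V = ⊕_{k ≥ 0} ⊕_{0 ≤ a ≤ k} N^a(P_{n+k})`;
(ii) each `Q^N_k` is a nondegenerate real bilinear form on `P_{n+k}`, symmetric if
`n+k` is even and alternating (antisymmetric) if `n+k` is odd;
(iii) every tuple `(h_k)` of `Q^N_k`-preserving real automorphisms of the `P_{n+k}`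
induces a unique `g ∈ Aut(V,Q)` commuting with `N` with `g(N^a v) = N^a(h_k v)`;
(iv) the resulting map `∏_k Aut(P_{n+k}, Q^N_k) → Aut(V,Q)` is an injective group
homomorphism. -/
theorem stmt5 {W : Type*} [AddCommGroup W] [Module ℂ W] [FiniteDimensional ℂ W]
    (n : ℕ)
    (σ : W →ₛₗ[starRingEnd ℂ] W) (hσ : ∀ v, σ (σ v) = v)
    (Q : W →ₗ[ℂ] W →ₗ[ℂ] ℂ)
    (hQreal : ∀ u v, Q (σ u) (σ v) = starRingEnd ℂ (Q u v))
    (hQnondeg : ∀ u, (∀ v, Q u v = 0) → u = 0)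
    (hQsym : Even n → ∀ u v, Q u v = Q v u)
    (hQalt : Odd n → ∀ u v, Q u v = - Q v u)
    (I : ℤ → ℤ → Submodule ℂ W) (N : W →ₗ[ℂ] W)
    (hPMHS : IsRSplitPMHS (n : ℤ) σ Q I N) :
    -- (i) V = ⊕_{k ≥ 0} ⊕_{0 ≤ a ≤ k} N^a(P_{n+k})
    (iSupIndep (fun x : Σ k : ℕ, Fin (k + 1) =>
        Submodule.map ((N ^ (x.2 : ℕ)).restrictScalars ℝ) (realPrim (n : ℤ) σ I N x.1)) ∧
      (⨆ x : Σ k : ℕ, Fin (k + 1),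
        Submodule.map ((N ^ (x.2 : ℕ)).restrictScalars ℝ) (realPrim (n : ℤ) σ I N x.1)) =
          realIn σ ⊤) ∧
    -- (ii) Q^N_k is real-valued, nondegenerate, symmetric iff `n+k` even
    (∀ k : ℕ,
      (∀ u v : W, u ∈ realPrim (n : ℤ) σ I N k → v ∈ realPrim (n : ℤ) σ I N k →
          (Q u ((N ^ k) v)).im = 0) ∧
      (∀ u : W, u ∈ realPrim (n : ℤ) σ I N k →
          (∀ v : W, v ∈ realPrim (n : ℤ) σ I N k → Q u ((N ^ k) v) = 0) → u = 0) ∧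
      (Even (n + k) → ∀ u v : W, u ∈ realPrim (n : ℤ) σ I N k →
          v ∈ realPrim (n : ℤ) σ I N k → Q u ((N ^ k) v) = Q v ((N ^ k) u)) ∧
      (Odd (n + k) → ∀ u v : W, u ∈ realPrim (n : ℤ) σ I N k →
          v ∈ realPrim (n : ℤ) σ I N k → Q u ((N ^ k) v) = - Q v ((N ^ k) u))) ∧
    -- (iii) existence and uniqueness of the induced `g ∈ Aut(V,Q)`
    (∀ h : ∀ k : ℕ, ↥(realPrim (n : ℤ) σ I N k) ≃ₗ[ℝ] ↥(realPrim (n : ℤ) σ I N k),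
      PreservesQk (n : ℤ) σ Q I N h →
        ∃! g : W ≃ₗ[ℂ] W, RealizesAut (n : ℤ) σ Q I N h g) ∧
    -- (iv) the map is multiplicative …
    (∀ h h' : ∀ k : ℕ, ↥(realPrim (n : ℤ) σ I N k) ≃ₗ[ℝ] ↥(realPrim (n : ℤ) σ I N k),
      ∀ g g' : W ≃ₗ[ℂ] W,
        PreservesQk (n : ℤ) σ Q I N h → PreservesQk (n : ℤ) σ Q I N h' →
        RealizesAut (n : ℤ) σ Q I N h g → RealizesAut (n : ℤ) σ Q I N h' g' →
          RealizesAut (n : ℤ) σ Q I N (fun k => (h' k).trans (h k)) (g'.trans g)) ∧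
    -- … and injective
    (∀ h h' : ∀ k : ℕ, ↥(realPrim (n : ℤ) σ I N k) ≃ₗ[ℝ] ↥(realPrim (n : ℤ) σ I N k),
      ∀ g : W ≃ₗ[ℂ] W,
        PreservesQk (n : ℤ) σ Q I N h → PreservesQk (n : ℤ) σ Q I N h' →
        RealizesAut (n : ℤ) σ Q I N h g → RealizesAut (n : ℤ) σ Q I N h' g →
          ∀ k : ℕ, h k = h' k) := by
  obtain ⟨⟨m, hm⟩, hskew, -, -, hσN, -, -, htop, hσI, hN, horth, hiso, -⟩ := hPMHS
  replace hskew : ∀ u v, Q (N u) v + Q u (N v) = 0 := fun u v => hskew u trivial v trivial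
  replace hσN : ∀ v, N (σ v) = σ (N v) := fun v => hσN v trivial
  have hconj : ∀ k, ∀ v ∈ primC (n : ℤ) I N k, σ v ∈ primC (n : ℤ) I N k :=
    primC_conj_mem hσN hσI
  have hspan := iSup_map_pow_primC_eq_top (n := (n : ℤ)) ⟨m, fun v => hm v trivial⟩ htop hN hiso
  have hind := iSupIndep_map_pow_primC hQnondeg hskew hN horth hspan
  refine ⟨⟨?_, iSup_map_pow_realPrim hσ hσN hconj hspan⟩, ?_, ?_, ?_, ?_⟩
  · refine iSupIndep_of_le_restrictScalars hind ?_
    rintro ⟨k, a⟩ _ ⟨u, hu, rfl⟩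
    exact Submodule.mem_map_of_mem hu.1
  · refine fun k => ⟨fun u v hu hv => ?_, fun u hu h => ?_, fun hk u v _ _ => ?_,
      fun hk u v _ _ => ?_⟩
    · rw [← Complex.conj_eq_iff_im, ← hQreal, ← pow_conj hσN, hu.2, hv.2]
    · refine eq_zero_of_form_pow_primC_eq_zero hQnondeg hskew hN horth hspan hu.1 fun v hv => ?_
      obtain ⟨x, hx, y, hy, rfl⟩ := exists_realIn_add_I_smul hσ (hconj k) hv
      simp [h x hx, h y hy]
    · rcases Nat.even_or_odd n with hn | hn
      · rw [hQsym hn, pow_skew hskew, ((Nat.even_add.1 hk).1 hn).neg_one_pow, one_mul]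
      · rw [hQalt hn, pow_skew hskew, ((Nat.even_add'.1 hk).1 hn).neg_one_pow]
        ring
    · rcases Nat.even_or_odd n with hn | hn
      · rw [hQsym hn, pow_skew hskew, ((Nat.odd_add'.1 hk).2 hn).neg_one_pow]
        ring
      · rw [hQalt hn, pow_skew hskew, ((Nat.odd_add.1 hk).1 hn).neg_one_pow, one_mul]
  · intro h hh
    choose F hF using fun k => exists_complexLinear_extension hσ (hconj k)
      ((realPrim (n : ℤ) σ I N k).subtype ∘ₗ (h k).toLinearMap)
    obtain ⟨G, hG⟩ := exists_linearMap_of_iSupIndep_map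
      (P := fun x : Σ k : ℕ, Fin (k + 1) => primC (n : ℤ) I N x.1)
      (A := fun x => N ^ (x.2 : ℕ))
      (fun x u hu h0 => eq_zero_of_pow_primC_eq_zero hQnondeg hskew hN horth hspan
        (Nat.lt_succ_iff.1 x.2.2) hu h0)
      hind hspan (fun x => (N ^ (x.2 : ℕ)) ∘ₗ F x.1)
    have hGr : ∀ k a : ℕ, a ≤ k → ∀ v : realPrim (n : ℤ) σ I N k,
        G ((N ^ a) (v : W)) = (N ^ a) (h k v : W) := by
      intro k a ha v
      have := hG ⟨k, ⟨a, by omega⟩⟩ ⟨v, v.2.1⟩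
      exact this.trans (congrArg (N ^ a) (hF k v))
    have hGσ : ∀ v, G (σ v) = σ (G v) := by
      have : LinearMap.eqLocus (G.comp σ) (σ.comp G) = ⊤ := by
        refine eq_top_of_pow_realPrim_mem hσ hconj hspan fun k a ha v hv => ?_
        simp only [LinearMap.mem_eqLocus, LinearMap.comp_apply]
        rw [← pow_conj hσN, hv.2, hGr k a ha ⟨v, hv⟩, ← pow_conj hσN, (h k ⟨v, hv⟩).2.2]
      exact fun v => LinearMap.congr_fun (LinearMap.eqLocus_eq_top.1 this) v
    have hGN : ∀ v, G (N v) = N (G v) := by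
      have : LinearMap.eqLocus (G.comp N) (N.comp G) = ⊤ := by
        refine eq_top_of_pow_realPrim_mem hσ hconj hspan fun k a ha v hv => ?_
        simp only [LinearMap.mem_eqLocus, LinearMap.comp_apply]
        rw [hGr k a ha ⟨v, hv⟩, ← Module.End.mul_apply N, ← Module.End.mul_apply N, ← pow_succ']
        rcases ha.lt_or_eq with ha | rfl
        · exact hGr k (a + 1) ha ⟨v, hv⟩
        · rw [pow_eq_zero_of_mem_primC hv.1 a.lt_succ_self,
            pow_eq_zero_of_mem_primC (h a ⟨v, hv⟩).2.1 a.lt_succ_self, map_zero]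
      exact fun v => LinearMap.congr_fun (LinearMap.eqLocus_eq_top.1 this) v
    have hGQ : ∀ u v, Q (G u) (G v) = Q u v := by
      have : LinearMap.eqLocus (Q.compl₁₂ G G) Q = ⊤ := by
        refine eq_top_of_pow_realPrim_mem hσ hconj hspan fun k a ha u hu => ?_
        rw [LinearMap.mem_eqLocus, ← LinearMap.eqLocus_eq_top]
        refine eq_top_of_pow_realPrim_mem hσ hconj hspan fun l b hb v hv => ?_
        rw [LinearMap.mem_eqLocus, LinearMap.compl₁₂_apply, hGr k a ha ⟨u, hu⟩,
          hGr l b hb ⟨v, hv⟩]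
        by_cases hkl : k = l ∧ a + b = k
        · obtain ⟨rfl, hab⟩ := hkl
          rw [pow_skew hskew, pow_skew hskew, ← Module.End.mul_apply, ← Module.End.mul_apply,
            ← pow_add, hab, hh k ⟨u, hu⟩ ⟨v, hv⟩]
        · rw [form_pow_primC_eq_zero hskew hN horth hkl hu.1 hv.1,
            form_pow_primC_eq_zero hskew hN horth hkl (h k ⟨u, hu⟩).2.1 (h l ⟨v, hv⟩).2.1]
      exact fun u v => LinearMap.congr_fun₂ (LinearMap.eqLocus_eq_top.1 this) u v
    have hGinj : Function.Injective G := by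
      rw [injective_iff_map_eq_zero]
      exact fun u hu => hQnondeg u fun v => by rw [← hGQ, hu, map_zero, LinearMap.zero_apply]
    refine ⟨LinearEquiv.ofInjectiveEndo G hGinj, ⟨hGσ, hGQ, hGN, hGr⟩, fun g hg => ?_⟩
    have : LinearMap.eqLocus g.toLinearMap G = ⊤ :=
      eq_top_of_pow_realPrim_mem hσ hconj hspan fun k a ha v hv =>
        (hg.2.2.2 k a ha ⟨v, hv⟩).trans (hGr k a ha ⟨v, hv⟩).symm
    exact LinearEquiv.ext fun v => LinearMap.congr_fun (LinearMap.eqLocus_eq_top.1 this) v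
  · rintro h h' g g' - - ⟨hσg, hQg, hNg, hg⟩ ⟨hσg', hQg', hNg', hg'⟩
    refine ⟨fun v => ?_, fun u v => ?_, fun v => ?_, fun k a ha v => ?_⟩
    · simp [hσg', hσg]
    · simp [hQg, hQg']
    · simp [hNg', hNg]
    · simp [hg' k a ha, hg k a ha]
  · intro h h' g _ _ hg hg' k
    refine LinearEquiv.ext fun v => Subtype.ext ?_
    simpa using (hg.2.2.2 k 0 k.zero_le v).symm.trans (hg'.2.2.2 k 0 k.zero_le v)
end
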